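/- arXiv:1903.03541 — 7 statements merged into one kernel-verified Lean document; each statement's English description precedes it below -/
import Mathlib

section
/- Let (A,R) be a (one-sorted) linear space. Define a relation E on the set of ordered pairs (a,b) ∈ A² with a ≠ b by: (a,b) E (c,d) if and only if {a,b} = {c,d} or {a,b} ∪ {c,d} is an R-clique. Then E is an equivalence relation, and the two-sorted incidence structure F(A) — whose points are the pairs (a,a) for a ∈ A, whose lines are the E-equivalence classes, and where (p,p) is incident to the class [(a,b)]_E iff p ∈ {c,d} for some (c,d) with (c,d) E (a,b) — is a two-sorted linear space: any two distinct points are incident to exactly one common line, and every line is incident to at least two points. -/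
open scoped Classical

/-- A (one-sorted) linear space: a ternary collinearity relation that holds only of
pairwise distinct triples, is invariant under all permutations of its arguments, and
satisfies: `R x y z` and `R x y w` (with `z ≠ w`) imply `R x w z`. -/
structure IsLinearSpace {M : Type*} (R : M → M → M → Prop) : Prop where
  ne12 : ∀ {a b c : M}, R a b c → a ≠ b
  ne23 : ∀ {a b c : M}, R a b c → b ≠ c
  ne13 : ∀ {a b c : M}, R a b c → a ≠ c
  swap12 : ∀ {a b c : M}, R a b c → R b a c
  swap23 : ∀ {a b c : M}, R a b c → R a c b
  line : ∀ {x y z w : M}, R x y z → R x y w → z ≠ w → R x w z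

/-- `X` is an `R`-clique: every three pairwise distinct elements of `X` satisfy `R`. -/
def RClique {M : Type*} (R : M → M → M → Prop) (X : Set M) : Prop :=
  ∀ a ∈ X, ∀ b ∈ X, ∀ c ∈ X, a ≠ b → b ≠ c → a ≠ c → R a b c

/-- The relation `E` on ordered pairs: `(a,b) E (c,d)` iff `{a,b} = {c,d}` or
`{a,b} ∪ {c,d}` is an `R`-clique. -/
def pairE {M : Type*} (R : M → M → M → Prop) (p q : M × M) : Prop :=
  ({p.1, p.2} : Set M) = {q.1, q.2} ∨ RClique R ({p.1, p.2, q.1, q.2} : Set M)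

/-- Incidence in `F(A)`: the point `p` (i.e. `(p,p)`) is incident to the `E`-class of the
pair `ℓ` iff there is a pair `(c,d)` of distinct points with `(c,d) E ℓ` and `p ∈ {c,d}`. -/
def FInc {M : Type*} (R : M → M → M → Prop) (p : M) (ℓ : M × M) : Prop :=
  ∃ q : M × M, q.1 ≠ q.2 ∧ pairE R q ℓ ∧ (p = q.1 ∨ p = q.2)

/-- The line through `a` and `b`: the two points and all points collinear with them. -/
def lineThrough {M : Type*} (R : M → M → M → Prop) (a b : M) : Set M :=
  {x | x = a ∨ x = b ∨ R a b x}

theorem left_mem_lineThrough {M : Type*} (R : M → M → M → Prop) (a b : M) :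
    a ∈ lineThrough R a b := Or.inl rfl

theorem right_mem_lineThrough {M : Type*} (R : M → M → M → Prop) (a b : M) :
    b ∈ lineThrough R a b := Or.inr (Or.inl rfl)

theorem RClique.mono {M : Type*} {R : M → M → M → Prop} {X Y : Set M}
    (hY : RClique R Y) (h : X ⊆ Y) : RClique R X :=
  fun a ha b hb c hc => hY a (h ha) b (h hb) c (h hc)

theorem RClique.mem_lineThrough {M : Type*} {R : M → M → M → Prop} {X : Set M}
    (hX : RClique R X) {a b x : M} (ha : a ∈ X) (hb : b ∈ X) (hx : x ∈ X) (hab : a ≠ b) :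
    x ∈ lineThrough R a b := by
  by_cases hxa : x = a
  · exact Or.inl hxa
  by_cases hxb : x = b
  · exact Or.inr (Or.inl hxb)
  exact Or.inr (Or.inr (hX a ha b hb x hx hab (Ne.symm hxb) (Ne.symm hxa)))

namespace IsLinearSpace

variable {M : Type*} {R : M → M → M → Prop}

theorem rClique_lineThrough (h : IsLinearSpace R) (a b : M) :
    RClique R (lineThrough R a b) := by
  have left : ∀ {z w : M}, R a b z → R a b w → z ≠ w → R a z w :=
    fun hz hw hzw => h.swap23 (h.line hz hw hzw)
  have right : ∀ {z w : M}, R a b z → R a b w → z ≠ w → R b z w :=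
    fun hz hw hzw => h.swap23 (h.line (h.swap12 hz) (h.swap12 hw) hzw)
  have rot : ∀ {x y z : M}, R x y z → R y z x := fun hx => h.swap23 (h.swap12 hx)
  rintro x (rfl | rfl | hx) y (rfl | rfl | hy) z (rfl | rfl | hz) hxy hyz hxz
  all_goals first
    | exact absurd rfl hxy
    | exact absurd rfl hyz
    | exact absurd rfl hxz
    | assumption
    | exact h.swap12 ‹_›
    | exact h.swap23 ‹_›
    | exact rot ‹_›
    | exact rot (rot ‹_›)
    | exact h.swap12 (rot ‹_›)
    | exact left hy hz hyz
    | exact right hy hz hyz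
    | exact h.swap12 (left hx hz hxz)
    | exact h.swap12 (right hx hz hxz)
    | exact rot (left hx hy hxy)
    | exact rot (right hx hy hxy)
    | exact h.swap23 (h.line (h.swap12 (left hx hy hxy)) (h.swap12 (left hx hz hxz)) hyz)

theorem lineThrough_eq (h : IsLinearSpace R) {a b c d : M} (hab : a ≠ b) (hcd : c ≠ d)
    (hc : c ∈ lineThrough R a b) (hd : d ∈ lineThrough R a b) :
    lineThrough R a b = lineThrough R c d := by
  have hsub : lineThrough R a b ⊆ lineThrough R c d := fun _ hx =>
    (h.rClique_lineThrough a b).mem_lineThrough hc hd hx hcd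
  exact hsub.antisymm fun _ hx => (h.rClique_lineThrough c d).mem_lineThrough
    (hsub (left_mem_lineThrough R a b)) (hsub (right_mem_lineThrough R a b)) hx hab

theorem pairE_iff (h : IsLinearSpace R) {p q : M × M} (hp : p.1 ≠ p.2) (hq : q.1 ≠ q.2) :
    pairE R p q ↔ lineThrough R p.1 p.2 = lineThrough R q.1 q.2 := by
  constructor
  · rintro (heq | hcl)
    · have hsub : ∀ x ∈ ({q.1, q.2} : Set M), x ∈ lineThrough R p.1 p.2 := by
        rw [← heq]
        rintro x (rfl | rfl)
        · exact left_mem_lineThrough R _ _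
        · exact right_mem_lineThrough R _ _
      exact h.lineThrough_eq hp hq (hsub _ (by simp)) (hsub _ (by simp))
    · exact h.lineThrough_eq hp hq
        (hcl.mem_lineThrough (by simp) (by simp) (by simp) hp)
        (hcl.mem_lineThrough (by simp) (by simp) (by simp) hp)
  · intro heq
    refine Or.inr ((h.rClique_lineThrough p.1 p.2).mono ?_)
    rintro x (rfl | rfl | rfl | rfl)
    · exact left_mem_lineThrough R _ _
    · exact right_mem_lineThrough R _ _
    · exact heq ▸ left_mem_lineThrough R _ _
    · exact heq ▸ right_mem_lineThrough R _ _

theorem mem_lineThrough_of_fInc (h : IsLinearSpace R) {p : M} {l : M × M} (hl : l.1 ≠ l.2)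
    (hp : FInc R p l) : p ∈ lineThrough R l.1 l.2 := by
  obtain ⟨q, hq, hE, rfl | rfl⟩ := hp <;> rw [← (h.pairE_iff hq hl).1 hE]
  · exact left_mem_lineThrough R _ _
  · exact right_mem_lineThrough R _ _

end IsLinearSpace

theorem fInc_fst {M : Type*} (R : M → M → M → Prop) {l : M × M} (hl : l.1 ≠ l.2) :
    FInc R l.1 l := ⟨l, hl, Or.inl rfl, Or.inl rfl⟩

theorem fInc_snd {M : Type*} (R : M → M → M → Prop) {l : M × M} (hl : l.1 ≠ l.2) :
    FInc R l.2 l := ⟨l, hl, Or.inl rfl, Or.inr rfl⟩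

/-- `E` is an equivalence relation on pairs of distinct points, and the two-sorted
structure `F(A)` (points: the diagonal pairs; lines: the `E`-classes; incidence `FInc`)
is a two-sorted linear space: any two distinct points are incident to exactly one common
line (uniqueness up to `E`-equivalence of representatives), and every line is incident to
at least two points. -/
theorem oneSorted_to_twoSorted_linearSpace {M : Type*} (R : M → M → M → Prop)
    (hLS : IsLinearSpace R) :
    Equivalence (fun p q : {x : M × M // x.1 ≠ x.2} => pairE R p.1 q.1) ∧
    (∀ p q : M, p ≠ q →
      ∃ ℓ : {x : M × M // x.1 ≠ x.2}, FInc R p ℓ.1 ∧ FInc R q ℓ.1) ∧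
    (∀ p q : M, p ≠ q → ∀ ℓ ℓ' : {x : M × M // x.1 ≠ x.2},
      FInc R p ℓ.1 → FInc R q ℓ.1 → FInc R p ℓ'.1 → FInc R q ℓ'.1 →
        pairE R ℓ.1 ℓ'.1) ∧
    (∀ ℓ : {x : M × M // x.1 ≠ x.2}, ∃ p q : M, p ≠ q ∧ FInc R p ℓ.1 ∧ FInc R q ℓ.1) := by
  refine ⟨⟨fun _ => Or.inl rfl, fun {p q} hpq => ?_, fun {p q r} hpq hqr => ?_⟩, fun p q hpq => ?_,
    fun p q hpq l l' hpl hql hpl' hql' => ?_, fun l => ?_⟩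
  · exact (hLS.pairE_iff q.2 p.2).2 ((hLS.pairE_iff p.2 q.2).1 hpq).symm
  · exact (hLS.pairE_iff p.2 r.2).2
      (((hLS.pairE_iff p.2 q.2).1 hpq).trans ((hLS.pairE_iff q.2 r.2).1 hqr))
  · exact ⟨⟨(p, q), hpq⟩, fInc_fst R hpq, fInc_snd R hpq⟩
  · have hl := hLS.lineThrough_eq l.2 hpq (hLS.mem_lineThrough_of_fInc l.2 hpl)
      (hLS.mem_lineThrough_of_fInc l.2 hql)
    have hl' := hLS.lineThrough_eq l'.2 hpq (hLS.mem_lineThrough_of_fInc l'.2 hpl')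
      (hLS.mem_lineThrough_of_fInc l'.2 hql')
    exact (hLS.pairE_iff l.2 l'.2).2 (hl.trans hl'.symm)
  · exact ⟨l.1.1, l.1.2, l.2, fInc_fst R l.2, fInc_snd R l.2⟩
end

section
/- Let F and G be the interpretations between one-sorted and two-sorted linear spaces: for a one-sorted linear space (A,R), F(A) is the two-sorted structure whose points are the pairs (a,a), whose lines are the E-classes of pairs of distinct elements (where (a,b) E (c,d) iff {a,b} = {c,d} or {a,b} ∪ {c,d} is an R-clique), with (p,p) incident to [(a,b)]_E iff p ∈ {c,d} for some (c,d) E (a,b); and for a two-sorted linear space B, G(B) is the one-sorted structure on the points of B with R(a,b,c) iff a,b,c are distinct and lie on a common line of B. Then: (i) for every one-sorted linear space A and all pairwise distinct a,b,c ∈ A, R(a,b,c) holds in A if and only if the points (a,a), (b,b), (c,c) of F(A) are incident to a common line, so that (a,a) ↦ a is an isomorphism from G(F(A)) onto A; and (ii) for every two-sorted linear space B there is an isomorphism of incidence structures from B onto F(G(B)) sending each point p to (p,p). -/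
open scoped Classical

universe u v

/-- A two-sorted linear space. -/
structure TwoSortedLinearSpace {P L : Type*} (I : P → L → Prop) : Prop where
  unique_line : ∀ ⦃p q : P⦄, p ≠ q → ∃! ℓ : L, I p ℓ ∧ I q ℓ
  two_points : ∀ ℓ : L, ∃ p q : P, p ≠ q ∧ I p ℓ ∧ I q ℓ

/-- `G(B)`: the derived collinearity relation of a two-sorted linear space. -/
def derivedR {P : Type u} {L : Type v} (I : P → L → Prop) : P → P → P → Prop :=
  fun a b c => a ≠ b ∧ b ≠ c ∧ a ≠ c ∧ ∃ ℓ : L, I a ℓ ∧ I b ℓ ∧ I c ℓ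

/-- The points of `F(A)` on the line through `u` and `v` are `u`, `v` and those collinear with
them. -/
theorem fInc_iff {M : Type*} {R : M → M → M → Prop} (hR : IsLinearSpace R) {ℓ : M × M}
    (hℓ : ℓ.1 ≠ ℓ.2) (p : M) : FInc R p ℓ ↔ p = ℓ.1 ∨ p = ℓ.2 ∨ R ℓ.1 ℓ.2 p := by
  constructor
  · rintro ⟨q, -, hE | hE, hp⟩
    · have hmem : p ∈ ({ℓ.1, ℓ.2} : Set M) := hE ▸ hp
      rcases hmem with h | h
      · exact .inl h
      · exact .inr (.inl h)
    · by_cases h1 : p = ℓ.1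
      · exact .inl h1
      by_cases h2 : p = ℓ.2
      · exact .inr (.inl h2)
      refine .inr (.inr (hE _ (by simp) _ (by simp) _ ?_ hℓ (Ne.symm h2) (Ne.symm h1)))
      rcases hp with rfl | rfl <;> simp
  · rintro (h | h | h)
    · exact ⟨ℓ, hℓ, .inl rfl, .inl h⟩
    · exact ⟨ℓ, hℓ, .inl rfl, .inr h⟩
    · refine ⟨(ℓ.1, p), hR.ne13 h, .inr ?_, .inr rfl⟩
      have h₁ := hR.swap12 h
      have h₂ := hR.swap23 h
      have h₃ := hR.swap23 h₁
      have h₄ := hR.swap12 h₂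
      have h₅ := hR.swap12 h₃
      intro a ha b hb c hc hab hbc hac
      simp only [Set.mem_insert_iff, Set.mem_singleton_iff] at ha hb hc
      grind

/-- Any three distinct points on the line through `u` and `v` are collinear. -/
theorem IsLinearSpace.of_mem_line {M : Type*} {R : M → M → M → Prop} (hR : IsLinearSpace R)
    {u v a b c : M} (ha : a = u ∨ a = v ∨ R u v a) (hb : b = u ∨ b = v ∨ R u v b)
    (hc : c = u ∨ c = v ∨ R u v c) (hab : a ≠ b) (hbc : b ≠ c) (hac : a ≠ c) : R a b c := by
  have s₁ := @hR.swap12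
  have s₂ := @hR.swap23
  have hl := @hR.line
  have collinear_left : ∀ {x y : M}, R u v x → R u v y → x ≠ y → R x u y :=
    fun hx hy hxy => s₁ (hl hy hx hxy.symm)
  have collinear_right : ∀ {x y : M}, R u v x → R u v y → x ≠ y → R x v y :=
    fun hx hy hxy => s₁ (hl (s₁ hy) (s₁ hx) hxy.symm)
  rcases ha with rfl | rfl | ha <;> rcases hb with rfl | rfl | hb <;>
    rcases hc with rfl | rfl | hc
  all_goals first
    | contradiction
    | assumption
    | exact hl (collinear_left ha hc hac) (collinear_left ha hb hab) hbc.symm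
    | grind

theorem TwoSortedLinearSpace.line_eq {P : Type u} {L : Type v} {I : P → L → Prop}
    (hI : TwoSortedLinearSpace I) {p q : P} {ℓ ℓ' : L} (hpq : p ≠ q) (hp : I p ℓ) (hq : I q ℓ)
    (hp' : I p ℓ') (hq' : I q ℓ') : ℓ = ℓ' :=
  (hI.unique_line hpq).unique ⟨hp, hq⟩ ⟨hp', hq'⟩

theorem TwoSortedLinearSpace.isLinearSpace_derivedR {P : Type u} {L : Type v} {I : P → L → Prop}
    (hI : TwoSortedLinearSpace I) : IsLinearSpace (derivedR I) where
  ne12 h := h.1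
  ne23 h := h.2.1
  ne13 h := h.2.2.1
  swap12 := fun ⟨hab, hbc, hac, ℓ, ha, hb, hc⟩ => ⟨hab.symm, hac, hbc, ℓ, hb, ha, hc⟩
  swap23 := fun ⟨hab, hbc, hac, ℓ, ha, hb, hc⟩ => ⟨hac, hbc.symm, hab, ℓ, ha, hc, hb⟩
  line := by
    rintro x y z w ⟨hxy, -, hxz, ℓ, hx, hy, hz⟩ ⟨-, -, hxw, ℓ', hx', hy', hw⟩ hzw
    obtain rfl := hI.line_eq hxy hx hy hx' hy'
    exact ⟨hxw, hzw.symm, hxz, ℓ, hx, hw, hz⟩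

/-- The points of `F(G(B))` on the line through two points of `ℓ` are the points of `ℓ`. -/
theorem TwoSortedLinearSpace.fInc_derivedR_iff {P : Type u} {L : Type v} {I : P → L → Prop}
    (hI : TwoSortedLinearSpace I) {m : P × P} (hm : m.1 ≠ m.2) {ℓ : L} (h₁ : I m.1 ℓ)
    (h₂ : I m.2 ℓ) (p : P) : FInc (derivedR I) p m ↔ I p ℓ := by
  rw [fInc_iff hI.isLinearSpace_derivedR hm]
  constructor
  · rintro (rfl | rfl | ⟨-, -, -, ℓ', h₁', h₂', hp⟩)
    · exact h₁
    · exact h₂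
    · rwa [hI.line_eq hm h₁ h₂ h₁' h₂']
  · intro hp
    by_cases hp₁ : p = m.1
    · exact .inl hp₁
    by_cases hp₂ : p = m.2
    · exact .inr (.inl hp₂)
    exact .inr (.inr ⟨hm, Ne.symm hp₂, Ne.symm hp₁, ℓ, h₁, h₂, hp⟩)

theorem rClique_derivedR {P : Type u} {L : Type v} {I : P → L → Prop} {X : Set P} {ℓ : L}
    (hX : ∀ p ∈ X, I p ℓ) : RClique (derivedR I) X :=
  fun a ha b hb c hc hab hbc hac => ⟨hab, hbc, hac, ℓ, hX a ha, hX b hb, hX c hc⟩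

/-- Bi-interpretation: (i) for a one-sorted linear space `(A,R)`, three pairwise distinct
points satisfy `R` iff the corresponding diagonal points of `F(A)` are incident to a common
line, so `(a,a) ↦ a` is an isomorphism from `G(F(A))` onto `A`; (ii) for a two-sorted
linear space `B`, there is an isomorphism of incidence structures from `B` onto `F(G(B))`
sending each point `p` to `(p,p)`: the point map is `p ↦ (p,p)` (built into `FInc`), and
there is a map `g` on lines which preserves incidence and induces a bijection onto the
`E`-classes of `F(G(B))`. -/
theorem linearSpace_biinterpretation :
    (∀ (M : Type u) (R : M → M → M → Prop), IsLinearSpace R →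
      ∀ a b c : M, a ≠ b → b ≠ c → a ≠ c →
        (R a b c ↔ ∃ ℓ : {x : M × M // x.1 ≠ x.2},
          FInc R a ℓ.1 ∧ FInc R b ℓ.1 ∧ FInc R c ℓ.1)) ∧
    (∀ (P : Type u) (L : Type v) (I : P → L → Prop), TwoSortedLinearSpace I →
      ∃ g : L → {x : P × P // x.1 ≠ x.2},
        (∀ (p : P) (ℓ : L), I p ℓ ↔ FInc (derivedR I) p (g ℓ).1) ∧
        (∀ ℓ ℓ' : L, pairE (derivedR I) (g ℓ).1 (g ℓ').1 → ℓ = ℓ') ∧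
        (∀ m : {x : P × P // x.1 ≠ x.2}, ∃ ℓ : L, pairE (derivedR I) (g ℓ).1 m.1)) := by
  refine ⟨fun M R hR a b c hab hbc hac => ⟨fun h => ?_, ?_⟩, fun P L I hI => ?_⟩
  · refine ⟨⟨(a, b), hab⟩, ?_, ?_, ?_⟩ <;> rw [fInc_iff hR hab]
    · exact .inl rfl
    · exact .inr (.inl rfl)
    · exact .inr (.inr h)
  · rintro ⟨⟨ℓ, hℓ⟩, ha, hb, hc⟩
    rw [fInc_iff hR hℓ] at ha hb hc
    exact hR.of_mem_line ha hb hc hab hbc hac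
  · choose u v huv hu hv using hI.two_points
    have hinc (p : P) (ℓ : L) : FInc (derivedR I) p (u ℓ, v ℓ) ↔ I p ℓ :=
      hI.fInc_derivedR_iff (huv ℓ) (hu ℓ) (hv ℓ) p
    refine ⟨fun ℓ => ⟨(u ℓ, v ℓ), huv ℓ⟩, fun p ℓ => (hinc p ℓ).symm, fun ℓ ℓ' h => ?_, ?_⟩
    · exact hI.line_eq (huv ℓ) (hu ℓ) (hv ℓ)
        ((hinc _ _).1 ⟨_, huv ℓ, h, .inl rfl⟩) ((hinc _ _).1 ⟨_, huv ℓ, h, .inr rfl⟩)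
    · rintro ⟨⟨a, b⟩, hab⟩
      obtain ⟨ℓ, ⟨ha, hb⟩, -⟩ := hI.unique_line hab
      refine ⟨ℓ, .inr (rClique_derivedR (ℓ := ℓ) ?_)⟩
      rintro p (rfl | rfl | rfl | rfl)
      exacts [hu ℓ, hv ℓ, ha, hb]
end

section
/- Let (M,R) be a linear space such that: (i) every pair of distinct points a,b lies on a nontrivial line, i.e., there exists c with R(a,b,c); (ii) there exist three points of M that are not collinear (no nontrivial line contains all three and they are pairwise distinct); and (iii) every subset of M definable with parameters in the language with the single ternary relation R is finite or cofinite in M. Then every line of M is finite; that is, for all distinct a,b ∈ M the set {x ∈ M : R(a,b,x)} is finite. -/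
/-- The relation symbols of the vocabulary `τ`: a single ternary relation. -/
inductive TernRel : ℕ → Type
  | R : TernRel 3

/-- The vocabulary `τ` with a single ternary relation symbol and no function symbols. -/
def ternaryLang : FirstOrder.Language where
  Functions := fun _ => Empty
  Relations := TernRel

/-- The `τ`-structure on `M` interpreting the ternary relation symbol as `R`. -/
def ternaryStructure {M : Type*} (R : M → M → M → Prop) : ternaryLang.Structure M where
  funMap := fun f _ => f.elim
  RelMap := fun {n} r => match r with
    | TernRel.R => fun x => R (x 0) (x 1) (x 2)

/-- Trace of a line minus two of its points: definable with those two points as parameters. -/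
theorem definable_line {M : Type*} (R : M → M → M → Prop) (a b : M) :
    @Set.Definable₁ M (Set.univ : Set M) ternaryLang (ternaryStructure R) {x | R a b x} := by
  let := ternaryStructure R
  let r : (ternaryLang.withConstants (Set.univ : Set M)).Relations 3 := Sum.inl TernRel.R
  refine ⟨r.formula ![(ternaryLang.con (⟨a, Set.mem_univ _⟩ : (Set.univ : Set M))).term,
    (ternaryLang.con (⟨b, Set.mem_univ _⟩ : (Set.univ : Set M))).term,
    FirstOrder.Language.Term.var 0], ?_⟩
  ext v
  refine Iff.trans ?_ FirstOrder.Language.Formula.realize_rel.symm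
  change R a b (v 0) ↔ R _ _ _
  simp

namespace IsLinearSpace

variable {M : Type*} {R : M → M → M → Prop}

/-- A point collinear with two points of a line lies on that line. -/
theorem of_two_points (h : IsLinearSpace R) {a b p q c : M} (hp : R a b p) (hq : R a b q)
    (hc : R p q c) (ha : a ≠ c) (hb : b ≠ c) : R a b c := by
  have hpqa : R p q a := h.swap23 (h.swap12 (h.swap23 (h.line hp hq (h.ne12 hc))))
  have hpac : R p a c := h.swap23 (h.line hpqa hc ha)
  have hapb : R a p b := h.swap23 hp
  exact h.swap23 (h.line hapb (h.swap12 hpac) hb)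

/-- If every point lies on the line through `a` and `b`, any three distinct points are
collinear. -/
theorem collinear_of_forall (h : IsLinearSpace R) {a b : M}
    (hall : ∀ x, a ≠ x → b ≠ x → R a b x) {x y z : M} (hxy : x ≠ y) (hyz : y ≠ z)
    (hxz : x ≠ z) : R x y z := by
  have hax : ∀ {u v : M}, a ≠ u → a ≠ v → u ≠ v → R a u v := by
    intro u v hu hv huv
    rcases eq_or_ne b u with rfl | hbu
    · exact hall v hv huv
    rcases eq_or_ne b v with rfl | hbv
    · exact h.swap23 (hall u hu hbu)
    · exact h.swap23 (h.line (hall u hu hbu) (hall v hv hbv) huv)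
  rcases eq_or_ne a x with rfl | hx
  · exact hax hxy hxz hyz
  rcases eq_or_ne a y with rfl | hy
  · exact h.swap12 (hax hx hyz hxz)
  rcases eq_or_ne a z with rfl | hz
  · exact h.swap23 (h.swap12 (hax hx hy hxy))
  · exact h.swap23 (h.line (h.swap12 (hax hx hy hxy)) (h.swap12 (hax hx hz hxz)) hyz)

/-- If some point is off the line `ab` and every pair of points lies on a nonSet.mem_univ _ line,
then `ab` does not have more points than its complement. -/
theorem finite_line_of_finite_compl (h : IsLinearSpace R)
    (h1 : ∀ a b : M, a ≠ b → ∃ c : M, R a b c) {a b c : M} (ha : a ≠ c) (hb : b ≠ c)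
    (hc : ¬ R a b c) (hfin : ({x | R a b x}ᶜ : Set M).Finite) : {x | R a b x}.Finite := by
  have hex : ∀ p, R a b p → ∃ d, R c p d := fun p hp => h1 c p fun e => hc (e ▸ hp)
  choose! d hd using hex
  refine Set.Finite.of_injOn (f := d) ?_ ?_ hfin
  · intro p hp hdp
    exact hc (h.of_two_points hp hdp (h.swap23 (h.swap12 (hd p hp))) ha hb)
  · intro p hp q hq hpq
    by_contra hne
    have hpd := h.swap23 (hd p hp)
    have hqd := h.swap23 (hd q hq)
    rw [← hpq] at hqd
    have hcqp := h.line hpd hqd hne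
    exact hc (h.of_two_points hq hp (h.swap23 (h.swap12 hcqp)) ha hb)

end IsLinearSpace

/-- In a linear space `(M, R)` in which (i) every pair of distinct points lies on a
nonSet.mem_univ _ line, (ii) some three points are not collinear, and (iii) every subset of `M`
definable with parameters (in the vocabulary with the single ternary relation `R`) is
finite or cofinite, every line is finite. -/
theorem stronglyMinimal_linearSpace_lines_finite {M : Type*} (R : M → M → M → Prop)
    (hLS : IsLinearSpace R)
    (h1 : ∀ a b : M, a ≠ b → ∃ c : M, R a b c)
    (h2 : ∃ a b c : M, a ≠ b ∧ b ≠ c ∧ a ≠ c ∧ ¬ R a b c)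
    (h3 : ∀ s : Set M,
      @Set.Definable₁ M (Set.univ : Set M) ternaryLang (ternaryStructure R) s →
      s.Finite ∨ (sᶜ : Set M).Finite) :
    ∀ a b : M, a ≠ b → {x : M | R a b x}.Finite := by
  intro a b _
  obtain ⟨x, y, z, hxy, hyz, hxz, hnc⟩ := h2
  obtain ⟨c, ha, hb, hc⟩ : ∃ c, a ≠ c ∧ b ≠ c ∧ ¬ R a b c := by
    by_contra! hall
    exact hnc (hLS.collinear_of_forall hall hxy hyz hxz)
  exact (h3 _ (definable_line R a b)).elim id
    (hLS.finite_line_of_finite_compl h1 ha hb hc)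
end

section
/- Let A, B be disjoint finite subsets of a linear space with A ∪ B ∈ K₀ and B ≤ A ∪ B. Then: (1) if b ∈ B does not occur in any R-triple of A ∪ B, then δ(A/B) = δ(A/(B ∖ {b})), where δ(A/X) := δ(A ∪ X) − δ(X); (2) if moreover (B, A) is a good pair, then every b ∈ B occurs in some R-triple of A ∪ B. -/
open scoped Classical

/-- `X` is an `R`-clique: every three pairwise distinct elements of `X` satisfy `R`. -/
def FinClique {M : Type*} (R : M → M → M → Prop) (X : Finset M) : Prop :=
  ∀ a ∈ X, ∀ b ∈ X, ∀ c ∈ X, a ≠ b → b ≠ c → a ≠ c → R a b c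

/-- `ℓ` is a nontrivial line of the induced structure on `A`:
a maximal `R`-clique of `A` of size at least 3. -/
def IsLineOf {M : Type*} (R : M → M → M → Prop) (A ℓ : Finset M) : Prop :=
  ℓ ⊆ A ∧ 3 ≤ ℓ.card ∧ FinClique R ℓ ∧
    ∀ ℓ' : Finset M, ℓ' ⊆ A → FinClique R ℓ' → ℓ ⊆ ℓ' → ℓ' = ℓ

/-- The (finite) set of nontrivial lines of the induced structure on `A`. -/
noncomputable def linesOf {M : Type*} (R : M → M → M → Prop) (A : Finset M) :
    Finset (Finset M) :=
  A.powerset.filter fun ℓ => IsLineOf R A ℓ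

/-- The predimension `δ(A) = |A| - Σ_{ℓ ∈ L(A)} (|ℓ| - 2)`. -/
noncomputable def delta {M : Type*} (R : M → M → M → Prop) (A : Finset M) : ℤ :=
  (A.card : ℤ) - ∑ ℓ ∈ linesOf R A, ((ℓ.card : ℤ) - 2)

/-- Membership in the class `K₀`: all subsets have nonnegative predimension. -/
def InK0 {M : Type*} (R : M → M → M → Prop) (A : Finset M) : Prop :=
  ∀ A' ⊆ A, 0 ≤ delta R A'

/-- `A ≤ B`: `A` is a strong substructure of `B`. -/
def Strong {M : Type*} (R : M → M → M → Prop) (A B : Finset M) : Prop :=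
  A ⊆ B ∧ ∀ X : Finset M, A ⊆ X → X ⊆ B → delta R A ≤ delta R X

/-- `C` is a primitive extension of `B`. -/
def PrimitiveExt {M : Type*} (R : M → M → M → Prop) (B C : Finset M) : Prop :=
  Strong R B C ∧ ¬ ∃ A₀ : Finset M, B ⊂ A₀ ∧ A₀ ⊂ C ∧ Strong R B A₀ ∧ Strong R A₀ C

/-- `A` is `0`-primitive over `B` (with `A` the set of new points, disjoint from `B`). -/
def ZeroPrimOver {M : Type*} (R : M → M → M → Prop) (B A : Finset M) : Prop :=
  Disjoint B A ∧ A.Nonempty ∧ PrimitiveExt R B (B ∪ A) ∧ delta R (B ∪ A) = delta R B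

/-- `(B, A)` is a good pair. -/
def GoodPair {M : Type*} (R : M → M → M → Prop) (B A : Finset M) : Prop :=
  ZeroPrimOver R B A ∧ ∀ B' : Finset M, B' ⊂ B → ¬ ZeroPrimOver R B' A

/-- A point of an `R`-clique with at least three elements occurs in an `R`-triple of it. -/
theorem FinClique.exists_triple {M : Type*} {R : M → M → M → Prop} {ℓ : Finset M}
    (hℓ : FinClique R ℓ) (hcard : 3 ≤ ℓ.card) {b : M} (hb : b ∈ ℓ) :
    ∃ x ∈ ℓ, ∃ y ∈ ℓ, R b x y := by
  have h : 1 < (ℓ.erase b).card := by rw [Finset.card_erase_of_mem hb]; omega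
  obtain ⟨x, hx, y, hy, hxy⟩ := Finset.one_lt_card.mp h
  rw [Finset.mem_erase] at hx hy
  exact ⟨x, hx.2, y, hy.2, hℓ b hb x hx.2 y hy.2 hx.1.symm hxy hy.1.symm⟩

/-- Adding a point that occurs in no `R`-triple does not change the nontrivial lines. -/
theorem linesOf_insert {M : Type*} {R : M → M → M → Prop} {X : Finset M} {b : M}
    (h : ∀ x ∈ insert b X, ∀ y ∈ insert b X, ¬ R b x y) :
    linesOf R (insert b X) = linesOf R X := by
  have key : ∀ ℓ ⊆ insert b X, FinClique R ℓ → 3 ≤ ℓ.card → ℓ ⊆ X := by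
    intro ℓ hsub hcl hcard
    refine (Finset.subset_insert_iff_of_notMem fun hb => ?_).mp hsub
    obtain ⟨x, hx, y, hy, hR⟩ := hcl.exists_triple hcard hb
    exact h x (hsub hx) y (hsub hy) hR
  ext ℓ
  simp only [linesOf, Finset.mem_filter, Finset.mem_powerset]
  constructor
  · rintro ⟨hsub, -, hcard, hcl, hmax⟩
    have hX := key ℓ hsub hcl hcard
    exact ⟨hX, hX, hcard, hcl, fun ℓ' hℓ' =>
      hmax ℓ' (hℓ'.trans (Finset.subset_insert b X))⟩
  · rintro ⟨hX, -, hcard, hcl, hmax⟩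
    have hsub := hX.trans (Finset.subset_insert b X)
    exact ⟨hsub, hsub, hcard, hcl, fun ℓ' hℓ' hcl' hle =>
      hmax ℓ' (key ℓ' hℓ' hcl' (hcard.trans (Finset.card_le_card hle))) hcl' hle⟩

/-- Adding a point that occurs in no `R`-triple raises the predimension by one. -/
theorem delta_insert {M : Type*} {R : M → M → M → Prop} {X : Finset M} {b : M}
    (hb : b ∉ X) (h : ∀ x ∈ insert b X, ∀ y ∈ insert b X, ¬ R b x y) :
    delta R (insert b X) = delta R X + 1 := by
  rw [delta, delta, linesOf_insert h, Finset.card_insert_of_notMem hb]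
  push_cast
  ring

/-- Adding a point that occurs in no `R`-triple to both sets does not affect strength. -/
theorem strong_insert_iff {M : Type*} {R : M → M → M → Prop} {B C : Finset M} {b : M}
    (hb : b ∉ C) (hBC : B ⊆ C) (h : ∀ x ∈ insert b C, ∀ y ∈ insert b C, ¬ R b x y) :
    Strong R (insert b B) (insert b C) ↔ Strong R B C := by
  have hδ : ∀ X ⊆ C, delta R (insert b X) = delta R X + 1 := fun X hX =>
    delta_insert (fun hbX => hb (hX hbX)) fun x hx y hy =>
      h x (Finset.insert_subset_insert b hX hx) y (Finset.insert_subset_insert b hX hy)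
  constructor
  · rintro ⟨-, hs⟩
    refine ⟨hBC, fun X hBX hXC => ?_⟩
    have := hs (insert b X) (Finset.insert_subset_insert b hBX)
      (Finset.insert_subset_insert b hXC)
    rw [hδ B hBC, hδ X hXC] at this
    omega
  · rintro ⟨-, hs⟩
    refine ⟨Finset.insert_subset_insert b hBC, fun X hBX hXC => ?_⟩
    have hbX : b ∈ X := hBX (Finset.mem_insert_self b B)
    have hXC' : X.erase b ⊆ C := Finset.subset_insert_iff.mp hXC
    have hBX' : B ⊆ X.erase b :=
      Finset.subset_erase.mpr ⟨(Finset.subset_insert b B).trans hBX, fun hbB => hb (hBC hbB)⟩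
    have := hs (X.erase b) hBX' hXC'
    rw [← Finset.insert_erase hbX, hδ B hBC, hδ _ hXC']
    omega

/-- Being `0`-primitive is unaffected by removing from the base a point that occurs in no
`R`-triple. -/
theorem ZeroPrimOver.of_insert {M : Type*} {R : M → M → M → Prop} {B A : Finset M} {b : M}
    (hbB : b ∉ B) (h : ∀ x ∈ insert b (B ∪ A), ∀ y ∈ insert b (B ∪ A), ¬ R b x y)
    (hz : ZeroPrimOver R (insert b B) A) : ZeroPrimOver R B A := by
  obtain ⟨hdisj, hne, ⟨hstr, hprim⟩, hδ⟩ := hz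
  rw [Finset.disjoint_insert_left] at hdisj
  rw [Finset.insert_union] at hstr hprim hδ
  have hb : b ∉ B ∪ A := by simp [hbB, hdisj.1]
  have mono : ∀ {X : Finset M}, X ⊆ B ∪ A → ∀ x ∈ insert b X, ∀ y ∈ insert b X, ¬ R b x y :=
    fun hX x hx y hy =>
      h x (Finset.insert_subset_insert b hX hx) y (Finset.insert_subset_insert b hX hy)
  have hBsub : B ⊆ B ∪ A := Finset.subset_union_left
  refine ⟨hdisj.2, hne, ⟨(strong_insert_iff hb hBsub h).mp hstr, ?_⟩, ?_⟩
  · rintro ⟨A₀, hlt, hlt', hs, hs'⟩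
    have hbA₀ : b ∉ A₀ := fun hm => hb (hlt'.1 hm)
    refine hprim ⟨insert b A₀, ?_, ?_, (strong_insert_iff hbA₀ hlt.1 (mono hlt'.1)).mpr hs,
      (strong_insert_iff hb hlt'.1 h).mpr hs'⟩
    · exact ⟨Finset.insert_subset_insert b hlt.1,
        fun hle => hlt.2 ((Finset.insert_subset_insert_iff hbA₀).mp hle)⟩
    · exact ⟨Finset.insert_subset_insert b hlt'.1,
        fun hle => hlt'.2 ((Finset.insert_subset_insert_iff hb).mp hle)⟩
  · rw [delta_insert hb h, delta_insert hbB (mono hBsub)] at hδ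
    omega

/-- Let `A`, `B` be disjoint with `A ∪ B ∈ K₀` and `B ≤ A ∪ B`. Then (1) removing from
`B` a point `b` occurring in no `R`-triple of `A ∪ B` does not change the relative
predimension `δ(A/B)`; and (2) if `(B, A)` is a good pair then every `b ∈ B` occurs in
some `R`-triple of `A ∪ B`. -/
theorem base_points_occur_in_triples {M : Type*} (R : M → M → M → Prop)
    (hLS : IsLinearSpace R) (A B : Finset M) (hdisj : Disjoint A B)
    (hK0 : InK0 R (A ∪ B)) (hstrong : Strong R B (A ∪ B)) :
    (∀ b ∈ B, (∀ x ∈ A ∪ B, ∀ y ∈ A ∪ B, ¬ R b x y ∧ ¬ R x b y ∧ ¬ R x y b) →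
      delta R (A ∪ B) - delta R B =
        delta R (A ∪ B.erase b) - delta R (B.erase b)) ∧
    (GoodPair R B A →
      ∀ b ∈ B, ∃ x ∈ A ∪ B, ∃ y ∈ A ∪ B, R b x y ∨ R x b y ∨ R x y b) := by
  constructor
  · intro b hb h
    have hbA : b ∉ A := fun hA => Finset.disjoint_left.mp hdisj hA hb
    have hU : insert b (A ∪ B.erase b) = A ∪ B := by
      rw [← Finset.union_insert, Finset.insert_erase hb]
    have hA := delta_insert (R := R) (X := A ∪ B.erase b) (b := b) (by simp [hbA])
      (by rw [hU]; exact fun x hx y hy => (h x hx y hy).1)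
    have hB := delta_insert (R := R) (Finset.notMem_erase b B) (by
      rw [Finset.insert_erase hb]
      exact fun x hx y hy =>
        (h x (Finset.mem_union_right A hx) y (Finset.mem_union_right A hy)).1)
    rw [hU] at hA
    rw [Finset.insert_erase hb] at hB
    omega
  · rintro ⟨hz, hmin⟩ b hb
    by_contra! hno
    refine hmin (B.erase b) (Finset.erase_ssubset hb)
      (ZeroPrimOver.of_insert (Finset.notMem_erase b B) ?_ (by rwa [Finset.insert_erase hb]))
    rw [← Finset.insert_union, Finset.insert_erase hb, Finset.union_comm]
    exact fun x hx y hy => (hno x hx y hy).1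
end

section
/- Let C ∈ K₀ be a primitive extension of B ⊊ C. Then exactly one of the following holds: (1) δ(C) = δ(B) + 1 and |C ∖ B| = 1; or (2) δ(C) = δ(B). In particular, if δ(C) > δ(B) then C adds exactly one point to B. -/
open scoped Classical

/-- Every nontrivial line of `A` is the trace on `A` of a nontrivial line of a larger set. -/
theorem IsLineOf.exists_extension {M : Type*} {R : M → M → M → Prop} {A A' ℓ : Finset M}
    (hA : A ⊆ A') (hℓ : IsLineOf R A ℓ) :
    ∃ ℓ' : Finset M, IsLineOf R A' ℓ' ∧ ℓ ⊆ ℓ' ∧ ℓ' ∩ A = ℓ := by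
  obtain ⟨hsub, hcard, hcl, hmax⟩ := hℓ
  obtain ⟨ℓ', hle, hm⟩ := (A'.powerset.filter fun X => FinClique R X).exists_le_maximal
    (a := ℓ) (by simp [hsub.trans hA, hcl])
  have hmem := hm.prop
  simp only [Finset.mem_filter, Finset.mem_powerset] at hmem
  refine ⟨ℓ', ⟨hmem.1, hcard.trans (Finset.card_le_card hle), hmem.2, fun X hX hXc hX' => ?_⟩,
    hle, ?_⟩
  · exact (hm.eq_of_le (by simp [hX, hXc]) hX').symm
  · refine hmax _ Finset.inter_subset_right (fun a ha b hb c hc => ?_)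
      (Finset.subset_inter hle hsub)
    exact hmem.2 a (Finset.mem_inter.1 ha).1 b (Finset.mem_inter.1 hb).1
      c (Finset.mem_inter.1 hc).1

theorem isLineOf_of_mem_linesOf {M : Type*} {R : M → M → M → Prop} {A ℓ : Finset M}
    (h : ℓ ∈ linesOf R A) : IsLineOf R A ℓ :=
  (Finset.mem_filter.1 h).2

theorem mem_linesOf_of_isLineOf {M : Type*} {R : M → M → M → Prop} {A ℓ : Finset M}
    (h : IsLineOf R A ℓ) : ℓ ∈ linesOf R A :=
  Finset.mem_filter.2 ⟨Finset.mem_powerset.2 h.1, h⟩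

/-- The total weight of the nontrivial lines is monotone. -/
theorem sum_linesOf_mono {M : Type*} (R : M → M → M → Prop) {A A' : Finset M} (hA : A ⊆ A') :
    ∑ ℓ ∈ linesOf R A, ((ℓ.card : ℤ) - 2) ≤ ∑ ℓ ∈ linesOf R A', ((ℓ.card : ℤ) - 2) := by
  have hex : ∀ ℓ, ∃ ℓ' : Finset M, ℓ ∈ linesOf R A → IsLineOf R A' ℓ' ∧ ℓ ⊆ ℓ' ∧ ℓ' ∩ A = ℓ := by
    intro ℓ
    by_cases h : ℓ ∈ linesOf R A
    · obtain ⟨ℓ', hℓ'⟩ := (isLineOf_of_mem_linesOf h).exists_extension hA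
      exact ⟨ℓ', fun _ => hℓ'⟩
    · exact ⟨∅, fun h' => absurd h' h⟩
  choose e he using hex
  have hinj : Set.InjOn e (linesOf R A) := by
    intro x hx y hy hxy
    rw [← (he x hx).2.2, ← (he y hy).2.2, hxy]
  calc ∑ ℓ ∈ linesOf R A, ((ℓ.card : ℤ) - 2)
      ≤ ∑ ℓ ∈ linesOf R A, (((e ℓ).card : ℤ) - 2) := by
        refine Finset.sum_le_sum fun ℓ hℓ => ?_
        have := Finset.card_le_card (he ℓ hℓ).2.1
        omega
    _ = ∑ ℓ ∈ (linesOf R A).image e, ((ℓ.card : ℤ) - 2) := by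
        rw [Finset.sum_image hinj]
    _ ≤ ∑ ℓ ∈ linesOf R A', ((ℓ.card : ℤ) - 2) := by
        refine Finset.sum_le_sum_of_subset_of_nonneg ?_ fun ℓ hℓ _ => ?_
        · exact Finset.image_subset_iff.2 fun ℓ hℓ => mem_linesOf_of_isLineOf (he ℓ hℓ).1
        · have := (isLineOf_of_mem_linesOf hℓ).2.1
          omega

/-- Adding a point raises the predimension by at most one. -/
theorem delta_insert_le {M : Type*} (R : M → M → M → Prop) (A : Finset M) (c : M) :
    delta R (insert c A) ≤ delta R A + 1 := by
  have h₁ := sum_linesOf_mono R (Finset.subset_insert c A)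
  have h₂ := Finset.card_insert_le c A
  unfold delta
  omega

theorem Strong.of_subset {M : Type*} {R : M → M → M → Prop} {A B C : Finset M}
    (h : Strong R A C) (hAB : A ⊆ B) (hBC : B ⊆ C) : Strong R A B :=
  ⟨hAB, fun X hAX hXB => h.2 X hAX (hXB.trans hBC)⟩

theorem PrimitiveExt.eq_of_strong {M : Type*} {R : M → M → M → Prop} {A B C : Finset M}
    (h : PrimitiveExt R B C) (hBA : B ⊂ A) (hAC : Strong R A C) : A = C := by
  by_contra hne
  exact h.2 ⟨A, hBA, hAC.1.ssubset_of_ne hne, h.1.of_subset hBA.1 hAC.1, hAC⟩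

/-- The top of a primitive extension has least predimension among the proper extensions of the
base inside it. -/
theorem PrimitiveExt.delta_le {M : Type*} {R : M → M → M → Prop} {B C X : Finset M}
    (h : PrimitiveExt R B C) (hBX : B ⊂ X) (hXC : X ⊆ C) : delta R C ≤ delta R X := by
  obtain ⟨A, hA, hmin⟩ := (C.powerset.filter fun Y => B ⊂ Y).exists_min_image (delta R)
    ⟨X, by simp [hBX, hXC]⟩
  simp only [Finset.mem_filter, Finset.mem_powerset] at hA hmin
  have hAC : A = C := h.eq_of_strong hA.2
    ⟨hA.1, fun Y hAY hYC => hmin Y ⟨hYC, hA.2.trans_subset hAY⟩⟩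
  exact hAC ▸ hmin X ⟨hXC, hBX⟩

/-- A primitive extension that raises the predimension adds a single point. -/
theorem PrimitiveExt.of_delta_lt {M : Type*} {R : M → M → M → Prop} {B C : Finset M}
    (h : PrimitiveExt R B C) (hBC : B ⊂ C) (hlt : delta R B < delta R C) :
    delta R C = delta R B + 1 ∧ (C \ B).card = 1 := by
  obtain ⟨c, hcC, hcB⟩ := Finset.exists_of_ssubset hBC
  have hBc : B ⊂ insert c B := Finset.ssubset_insert hcB
  have hcBC : insert c B ⊆ C := Finset.insert_subset hcC hBC.1
  have h₁ := delta_insert_le R B c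
  have h₂ := h.delta_le hBc hcBC
  have heq : insert c B = C := h.eq_of_strong hBc ⟨hcBC, fun X hX hXC => by
    have := h.delta_le (hBc.trans_subset hX) hXC
    omega⟩
  refine ⟨by omega, ?_⟩
  rw [← heq, Finset.insert_sdiff_of_notMem _ hcB]
  simp

/-- Dichotomy for primitive extensions `B ⊊ C` with `C ∈ K₀`: exactly one of
(1) `δ(C) = δ(B) + 1` and `|C \ B| = 1`, or (2) `δ(C) = δ(B)` holds. In particular,
if `δ(C) > δ(B)` then `C` adds exactly one point to `B`. -/
theorem primitive_extension_dichotomy {M : Type*} (R : M → M → M → Prop)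
    (hLS : IsLinearSpace R) (B C : Finset M) (hK0 : InK0 R C) (hBC : B ⊂ C)
    (hprim : PrimitiveExt R B C) :
    ((delta R C = delta R B + 1 ∧ (C \ B).card = 1) ∨ delta R C = delta R B) ∧
    ¬ ((delta R C = delta R B + 1 ∧ (C \ B).card = 1) ∧ delta R C = delta R B) ∧
    (delta R B < delta R C → (C \ B).card = 1) := by
  have hle : delta R B ≤ delta R C := hprim.1.2 C hBC.1 subset_rfl
  refine ⟨?_, fun h => by omega, fun hlt => (hprim.of_delta_lt hBC hlt).2⟩
  rcases hle.lt_or_eq with hlt | heq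
  · exact Or.inl (hprim.of_delta_lt hBC hlt)
  · exact Or.inr heq.symm
end

section
/- Let C ∈ K₀ be a 0-primitive extension of B ⊊ C with |C ∖ B| ≥ 2. Then there is a unique B₀ ⊆ B such that (B₀, C ∖ B) is a good pair. Moreover, B₀ equals the set of b ∈ B lying on a common nontrivial line of C with some point of C ∖ B, and every such line is based in C ∖ B (i.e., contains at least two points of C ∖ B). -/
open scoped Classical

section Lines

variable {M : Type*} {R : M → M → M → Prop}

lemma mem_linesOf {C ℓ : Finset M} : ℓ ∈ linesOf R C ↔ IsLineOf R C ℓ := by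
  simp only [linesOf, Finset.mem_filter, Finset.mem_powerset, and_iff_right_iff_imp]
  exact fun h => h.1

lemma FinClique.mono {X Y : Finset M} (h : FinClique R Y) (hXY : X ⊆ Y) : FinClique R X :=
  fun a ha b hb c hc => h a (hXY ha) b (hXY hb) c (hXY hc)

lemma IsLinearSpace.rotate (hLS : IsLinearSpace R) {a b c : M} (h : R a b c) : R b c a :=
  hLS.swap23 (hLS.swap12 h)

/-- If `p` is collinear with two points of a clique, it is collinear with any two. -/
lemma FinClique.collinear (hLS : IsLinearSpace R) {ℓ : Finset M} (hℓ : FinClique R ℓ)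
    {x y p : M} (hx : x ∈ ℓ) (hy : y ∈ ℓ) (hp : R x y p) {a b : M} (ha : a ∈ ℓ) (hb : b ∈ ℓ)
    (hab : a ≠ b) (hap : a ≠ p) (hbp : b ≠ p) : R a b p := by
  have hxy := hLS.ne12 hp
  have aux : ∀ z ∈ ℓ, z ≠ p → z ≠ x → R x z p := by
    intro z hz hzp hzx
    by_cases hzy : z = y
    · exact hzy ▸ hp
    · exact hLS.line (hLS.swap23 (hLS.swap23 hp))
        (hℓ x hx y hy z hz hxy (Ne.symm hzy) (Ne.symm hzx)) (Ne.symm hzp)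
  by_cases hax : a = x
  · subst hax
    exact aux b hb hbp (Ne.symm hab)
  by_cases hbx : b = x
  · subst hbx
    exact hLS.swap12 (aux a ha hap hax)
  exact hLS.line (hLS.swap12 (aux a ha hap hax)) (hℓ a ha x hx b hb hax (Ne.symm hbx) hab)
    (Ne.symm hbp)

lemma FinClique.insert (hLS : IsLinearSpace R) {ℓ : Finset M} (hℓ : FinClique R ℓ)
    {x y p : M} (hx : x ∈ ℓ) (hy : y ∈ ℓ) (hp : R x y p) : FinClique R (insert p ℓ) := by
  have key : ∀ a ∈ ℓ, ∀ b ∈ ℓ, a ≠ b → a ≠ p → b ≠ p → R a b p :=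
    fun a ha b hb => hℓ.collinear hLS hx hy hp ha hb
  intro a ha b hb c hc hab hbc hac
  rcases Finset.mem_insert.1 ha with rfl | ha'
  · have hb' := (Finset.mem_insert.1 hb).resolve_left (Ne.symm hab)
    have hc' := (Finset.mem_insert.1 hc).resolve_left (Ne.symm hac)
    exact hLS.rotate (hLS.rotate (key b hb' c hc' hbc (Ne.symm hab) (Ne.symm hac)))
  rcases Finset.mem_insert.1 hb with rfl | hb'
  · have hc' := (Finset.mem_insert.1 hc).resolve_left (Ne.symm hbc)
    exact hLS.swap23 (key a ha' c hc' hac hab (Ne.symm hbc))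
  rcases Finset.mem_insert.1 hc with rfl | hc'
  · exact key a ha' b hb' hab hac hbc
  · exact hℓ a ha' b hb' c hc' hab hbc hac

lemma IsLineOf.mem_of_collinear (hLS : IsLinearSpace R) {C ℓ : Finset M} (hℓ : IsLineOf R C ℓ)
    {x y p : M} (hx : x ∈ ℓ) (hy : y ∈ ℓ) (hpC : p ∈ C) (hp : R x y p) : p ∈ ℓ := by
  rw [← hℓ.2.2.2 (insert p ℓ) (Finset.insert_subset hpC hℓ.1) (hℓ.2.2.1.insert hLS hx hy hp)
    (Finset.subset_insert _ _)]
  exact Finset.mem_insert_self _ _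

/-- A clique of `C` sharing two points with a line of `C` is contained in it. -/
lemma IsLineOf.clique_subset (hLS : IsLinearSpace R) {C ℓ m : Finset M} (hℓ : IsLineOf R C ℓ)
    (hmC : m ⊆ C) (hm : FinClique R m) (h : 1 < (ℓ ∩ m).card) : m ⊆ ℓ := by
  obtain ⟨x, hx, y, hy, hxy⟩ := Finset.one_lt_card.1 h
  rw [Finset.mem_inter] at hx hy
  intro p hp
  by_cases hpx : p = x
  · exact hpx ▸ hx.1
  by_cases hpy : p = y
  · exact hpy ▸ hy.1
  exact hℓ.mem_of_collinear hLS hx.1 hy.1 (hmC hp)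
    (hm x hx.2 y hy.2 p hp hxy (Ne.symm hpy) (Ne.symm hpx))

lemma IsLineOf.inter (hLS : IsLinearSpace R) {C X ℓ : Finset M} (hXC : X ⊆ C)
    (hℓ : IsLineOf R C ℓ) (h : 3 ≤ (ℓ ∩ X).card) : IsLineOf R X (ℓ ∩ X) := by
  refine ⟨Finset.inter_subset_right, h, hℓ.2.2.1.mono Finset.inter_subset_left, ?_⟩
  intro m hmX hm hsub
  refine Finset.Subset.antisymm (Finset.subset_inter ?_ hmX) hsub
  refine hℓ.clique_subset hLS (hmX.trans hXC) hm ?_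
  have := Finset.card_le_card (Finset.subset_inter Finset.inter_subset_left hsub)
  omega

lemma exists_isLineOf_superset {C m : Finset M} (hmC : m ⊆ C) (hm : FinClique R m)
    (h : 3 ≤ m.card) : ∃ ℓ, IsLineOf R C ℓ ∧ m ⊆ ℓ := by
  obtain ⟨ℓ, hmℓ, hℓ⟩ := (C.powerset.filter fun X => FinClique R X).exists_le_maximal
    (Finset.mem_filter.2 ⟨Finset.mem_powerset.2 hmC, hm⟩)
  have hℓ' := Finset.mem_filter.1 hℓ.1
  exact ⟨ℓ, ⟨Finset.mem_powerset.1 hℓ'.1, h.trans (Finset.card_le_card hmℓ), hℓ'.2,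
    fun k hkC hk hle => Finset.Subset.antisymm
      (hℓ.2 (Finset.mem_filter.2 ⟨Finset.mem_powerset.2 hkC, hk⟩) hle) hle⟩, hmℓ⟩

/-- The predimension of a subset computed from the lines of the ambient space. -/
lemma delta_eq_sum_linesOf (hLS : IsLinearSpace R) {C X : Finset M} (hXC : X ⊆ C) :
    delta R X = (X.card : ℤ) - ∑ ℓ ∈ linesOf R C, (((ℓ ∩ X).card - 2 : ℕ) : ℤ) := by
  unfold delta
  congr 1
  rw [← Finset.sum_filter_add_sum_filter_not (linesOf R C) (fun ℓ => 3 ≤ (ℓ ∩ X).card)]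
  have hz : ∑ ℓ ∈ linesOf R C with ¬ 3 ≤ (ℓ ∩ X).card, (((ℓ ∩ X).card - 2 : ℕ) : ℤ) = 0 := by
    refine Finset.sum_eq_zero fun ℓ hℓ => ?_
    have := (Finset.mem_filter.1 hℓ).2
    omega
  rw [hz, add_zero]
  symm
  refine Finset.sum_bij (fun ℓ _ => ℓ ∩ X) ?_ ?_ ?_ ?_
  · intro ℓ hℓ
    obtain ⟨hℓ, h⟩ := Finset.mem_filter.1 hℓ
    exact mem_linesOf.2 ((mem_linesOf.1 hℓ).inter hLS hXC h)
  · intro ℓ hℓ m hm heq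
    obtain ⟨hℓ, h⟩ := Finset.mem_filter.1 hℓ
    obtain ⟨hm, -⟩ := Finset.mem_filter.1 hm
    rw [mem_linesOf] at hℓ hm
    have hsub : ℓ ∩ X ⊆ ℓ ∩ m := Finset.subset_inter Finset.inter_subset_left
      (heq ▸ Finset.inter_subset_left)
    have hc := Finset.card_le_card hsub
    refine Finset.Subset.antisymm (hm.clique_subset hLS hℓ.1 hℓ.2.2.1 ?_)
      (hℓ.clique_subset hLS hm.1 hm.2.2.1 ?_)
    · rw [Finset.inter_comm]
      omega
    · omega
  · intro m hm
    rw [mem_linesOf] at hm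
    obtain ⟨ℓ, hℓ, hmℓ⟩ := exists_isLineOf_superset (hm.1.trans hXC) hm.2.2.1 hm.2.1
    have heq : ℓ ∩ X = m := hm.2.2.2 _ Finset.inter_subset_right
      (hℓ.2.2.1.mono Finset.inter_subset_left) (Finset.subset_inter hmℓ hm.1)
    exact ⟨ℓ, Finset.mem_filter.2 ⟨mem_linesOf.2 hℓ, heq ▸ hm.2.1⟩, heq⟩
  · intro ℓ hℓ
    have := (Finset.mem_filter.1 hℓ).2
    omega

/-- The relative predimension `δ(B ∪ Y) - δ(B)` as a sum over the lines of the ambient space. -/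
lemma delta_union_sub (hLS : IsLinearSpace R) {C B Y : Finset M} (hB : B ⊆ C) (hY : Y ⊆ C)
    (hd : Disjoint B Y) :
    delta R (B ∪ Y) - delta R B = (Y.card : ℤ) - ∑ ℓ ∈ linesOf R C,
      ((((ℓ ∩ B).card + (ℓ ∩ Y).card - 2 : ℕ) : ℤ) - (((ℓ ∩ B).card - 2 : ℕ) : ℤ)) := by
  have hcard : ∀ ℓ : Finset M, (ℓ ∩ (B ∪ Y)).card = (ℓ ∩ B).card + (ℓ ∩ Y).card := fun ℓ => by
    rw [Finset.inter_union_distrib_left, Finset.card_union_of_disjoint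
      (hd.mono Finset.inter_subset_right Finset.inter_subset_right)]
  rw [delta_eq_sum_linesOf hLS (Finset.union_subset hB hY), delta_eq_sum_linesOf hLS hB,
    Finset.card_union_of_disjoint hd, Finset.sum_sub_distrib]
  simp only [hcard]
  push_cast
  ring

lemma zeroPrimOver_iff {B A : Finset M} :
    ZeroPrimOver R B A ↔ Disjoint B A ∧ A.Nonempty ∧ delta R (B ∪ A) = delta R B ∧
      ∀ Y ⊂ A, Y.Nonempty → delta R B < delta R (B ∪ Y) := by
  constructor
  · rintro ⟨hd, hne, ⟨hs, hp⟩, h0⟩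
    refine ⟨hd, hne, h0, fun Y hY hYne => ?_⟩
    by_contra! hle
    have hBY : B ⊆ B ∪ Y := Finset.subset_union_left
    have hYA : B ∪ Y ⊆ B ∪ A := Finset.union_subset_union_right hY.1
    refine hp ⟨B ∪ Y, ⟨hBY, fun h => ?_⟩, ⟨hYA, fun h => ?_⟩,
      ⟨hBY, fun X hX hXY => hs.2 X hX (hXY.trans hYA)⟩,
      ⟨hYA, fun X hX hXA => hle.trans (hs.2 X (hBY.trans hX) hXA)⟩⟩
    · obtain ⟨y, hy⟩ := hYne
      exact Finset.disjoint_left.1 hd (h (Finset.mem_union_right _ hy)) (hY.1 hy)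
    · refine hY.2 fun a ha => ?_
      exact (Finset.mem_union.1 (h (Finset.mem_union_right _ ha))).resolve_left
        (Finset.disjoint_right.1 hd ha)
  · rintro ⟨hd, hne, h0, hlt⟩
    have key : ∀ X, B ⊂ X → X ⊂ B ∪ A → delta R B < delta R X := by
      intro X hBX hXA
      have hX : B ∪ (X \ B) = X := Finset.union_sdiff_of_subset hBX.1
      have hsub : X \ B ⊆ A := fun x hx => by
        rw [Finset.mem_sdiff] at hx
        exact (Finset.mem_union.1 (hXA.1 hx.1)).resolve_left hx.2
      rw [← hX]
      refine hlt _ ⟨hsub, fun h => hXA.2 ?_⟩ (Finset.sdiff_nonempty.2 hBX.2)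
      exact Finset.union_subset hBX.1 (h.trans Finset.sdiff_subset)
    refine ⟨hd, hne, ⟨⟨Finset.subset_union_left, fun X hBX hXA => ?_⟩, ?_⟩, h0⟩
    · rcases eq_or_ne B X with rfl | h1
      · exact le_rfl
      rcases eq_or_ne X (B ∪ A) with rfl | h2
      · exact h0.ge
      · exact (key X (hBX.ssubset_of_ne h1) (hXA.ssubset_of_ne h2)).le
    · rintro ⟨X, hBX, hXA, -, hs⟩
      have := hs.2 _ hXA.1 subset_rfl
      have := key X hBX hXA
      omega

/-- In a `0`-primitive extension by at least two points, a line containing a new point has at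
most one old point. -/
lemma ZeroPrimOver.card_inter_le_one (hLS : IsLinearSpace R) {B A : Finset M}
    (h : ZeroPrimOver R B A) (hcard : 2 ≤ A.card) {ℓ : Finset M} (hℓ : ℓ ∈ linesOf R (B ∪ A))
    (hA : (ℓ ∩ A).Nonempty) : (ℓ ∩ B).card ≤ 1 := by
  obtain ⟨hd, -, -, hlt⟩ := zeroPrimOver_iff.1 h
  obtain ⟨a, ha⟩ := hA
  rw [Finset.mem_inter] at ha
  by_contra! hc
  have haA : {a} ⊆ A := Finset.singleton_subset_iff.2 ha.2
  have hss : {a} ⊂ A := haA.ssubset_of_ne fun h => by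
    rw [← h, Finset.card_singleton] at hcard
    omega
  have hpos := hlt {a} hss (Finset.singleton_nonempty a)
  have hrel := delta_union_sub hLS (C := B ∪ A) Finset.subset_union_left
    (haA.trans Finset.subset_union_right) (hd.mono_right haA)
  have hle := Finset.single_le_sum (s := linesOf R (B ∪ A))
    (f := fun ℓ => (((ℓ ∩ B).card + (ℓ ∩ {a}).card - 2 : ℕ) : ℤ) - (((ℓ ∩ B).card - 2 : ℕ) : ℤ))
    (fun ℓ _ => by omega) hℓ
  rw [Finset.inter_singleton_of_mem ha.1] at hle
  simp only [Finset.card_singleton] at hle hrel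
  omega

/-- Points of `B` lying on a common line of `C` with a point outside `B`. -/
noncomputable def lineBase (R : M → M → M → Prop) (B C : Finset M) : Finset M :=
  B.filter fun b => ∃ ℓ ∈ linesOf R C, b ∈ ℓ ∧ (ℓ ∩ (C \ B)).Nonempty

lemma ZeroPrimOver.two_le_card_inter (hLS : IsLinearSpace R) {B A : Finset M}
    (h : ZeroPrimOver R B A) (hcard : 2 ≤ A.card) {ℓ : Finset M} (hℓ : ℓ ∈ linesOf R (B ∪ A))
    (hA : (ℓ ∩ A).Nonempty) : 2 ≤ (ℓ ∩ A).card := by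
  have h1 := h.card_inter_le_one hLS hcard hℓ hA
  have h2 := mem_linesOf.1 hℓ
  have h3 : ℓ = ℓ ∩ B ∪ ℓ ∩ A := by
    rw [← Finset.inter_union_distrib_left, Finset.inter_eq_left.2 h2.1]
  have h4 := Finset.card_union_le (ℓ ∩ B) (ℓ ∩ A)
  rw [← h3] at h4
  have := h2.2.1
  omega

/-- The sets `B' ⊆ B` over which the new points are `0`-primitive are those containing all
points of `B` on a line with a new point. -/
lemma ZeroPrimOver.zeroPrimOver_iff_lineBase_subset (hLS : IsLinearSpace R) {B B' C : Finset M}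
    (hBC : B ⊆ C) (h : ZeroPrimOver R B (C \ B)) (hcard : 2 ≤ (C \ B).card) (hB' : B' ⊆ B) :
    ZeroPrimOver R B' (C \ B) ↔ lineBase R B C ⊆ B' := by
  have hC : B ∪ C \ B = C := Finset.union_sdiff_of_subset hBC
  have hd : Disjoint B (C \ B) := Finset.disjoint_sdiff
  constructor
  · intro h' b hb
    obtain ⟨hbB, ℓ, hℓ, hbℓ, hA⟩ := Finset.mem_filter.1 hb
    by_contra hb'
    have h0 := (zeroPrimOver_iff.1 h).2.2.1
    have h0' := (zeroPrimOver_iff.1 h').2.2.1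
    have e := delta_union_sub hLS hBC Finset.sdiff_subset hd
    have e' := delta_union_sub hLS (hB'.trans hBC) Finset.sdiff_subset (hd.mono_left hB')
    have hℓ' : ℓ ∈ linesOf R (B ∪ C \ B) := hC.symm ▸ hℓ
    have h1 := h.card_inter_le_one hLS hcard hℓ' hA
    have h2 := h.two_le_card_inter hLS hcard hℓ' hA
    have hlt : (ℓ ∩ B').card < (ℓ ∩ B).card := by
      refine Finset.card_lt_card ⟨Finset.inter_subset_inter_left hB', fun hs => hb' ?_⟩
      exact (Finset.mem_inter.1 (hs (Finset.mem_inter.2 ⟨hbℓ, hbB⟩))).2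
    have hsum : ∑ ℓ ∈ linesOf R C, ((((ℓ ∩ B').card + (ℓ ∩ (C \ B)).card - 2 : ℕ) : ℤ)
          - (((ℓ ∩ B').card - 2 : ℕ) : ℤ)) <
        ∑ ℓ ∈ linesOf R C, ((((ℓ ∩ B).card + (ℓ ∩ (C \ B)).card - 2 : ℕ) : ℤ)
          - (((ℓ ∩ B).card - 2 : ℕ) : ℤ)) := by
      refine Finset.sum_lt_sum (fun m _ => ?_) ⟨ℓ, hℓ, by omega⟩
      have : (m ∩ B').card ≤ (m ∩ B).card :=
        Finset.card_le_card (Finset.inter_subset_inter_left hB')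
      omega
    omega
  · intro hsub
    have key : ∀ Y ⊆ C \ B,
        delta R (B' ∪ Y) - delta R B' = delta R (B ∪ Y) - delta R B := by
      intro Y hY
      rw [delta_union_sub hLS hBC (hY.trans Finset.sdiff_subset) (hd.mono_right hY),
        delta_union_sub hLS (hB'.trans hBC) (hY.trans Finset.sdiff_subset)
          (hd.mono hB' hY)]
      congr 1
      refine Finset.sum_congr rfl fun ℓ hℓ => ?_
      by_cases hA : (ℓ ∩ (C \ B)).Nonempty
      · have heq : ℓ ∩ B' = ℓ ∩ B := by
          refine Finset.Subset.antisymm (Finset.inter_subset_inter_left hB') fun b hb => ?_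
          rw [Finset.mem_inter] at hb ⊢
          exact ⟨hb.1, hsub (Finset.mem_filter.2 ⟨hb.2, ℓ, hℓ, hb.1, hA⟩)⟩
        rw [heq]
      · have hY0 : ℓ ∩ Y = ∅ := Finset.subset_empty.1
          (Finset.not_nonempty_iff_eq_empty.1 hA ▸ Finset.inter_subset_inter_left hY)
        simp [hY0]
    obtain ⟨-, hne, h0, hlt⟩ := zeroPrimOver_iff.1 h
    refine zeroPrimOver_iff.2 ⟨hd.mono_left hB', hne, ?_, fun Y hY hYne => ?_⟩
    · have := key _ subset_rfl
      omega
    · have := key Y hY.1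
      have := hlt Y hY hYne
      omega

lemma ZeroPrimOver.goodPair_iff (hLS : IsLinearSpace R) {B B₀ C : Finset M}
    (hBC : B ⊆ C) (h : ZeroPrimOver R B (C \ B)) (hcard : 2 ≤ (C \ B).card) (hB₀ : B₀ ⊆ B) :
    GoodPair R B₀ (C \ B) ↔ B₀ = lineBase R B C := by
  have hiff : ∀ B' ⊆ B, (ZeroPrimOver R B' (C \ B) ↔ lineBase R B C ⊆ B') :=
    fun B' hB' => h.zeroPrimOver_iff_lineBase_subset hLS hBC hcard hB'
  have hbase : lineBase R B C ⊆ B := Finset.filter_subset _ _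
  constructor
  · rintro ⟨hz, hmin⟩
    have hsub := (hiff _ hB₀).1 hz
    by_contra hne
    exact hmin _ (hsub.ssubset_of_ne (Ne.symm hne)) ((hiff _ hbase).2 subset_rfl)
  · rintro rfl
    exact ⟨(hiff _ hbase).2 subset_rfl,
      fun B' hB' hz => hB'.2 ((hiff _ (hB'.1.trans hbase)).1 hz)⟩

end Lines

/-- For a `0`-primitive extension `B ⊊ C` in `K₀` with `|C \ B| ≥ 2`: there is a unique
`B₀ ⊆ B` with `(B₀, C \ B)` a good pair; moreover `B₀` is exactly the set of points of
`B` lying on a common nontrivial line of `C` with a point of `C \ B`, and every line of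
`C` meeting both `B` and `C \ B` is based in `C \ B`. -/
theorem zero_primitive_unique_base {M : Type*} (R : M → M → M → Prop)
    (hLS : IsLinearSpace R) (B C : Finset M) (hK0 : InK0 R C) (hBC : B ⊂ C)
    (hprim : PrimitiveExt R B C) (h0 : delta R C = delta R B)
    (hcard : 2 ≤ (C \ B).card) :
    (∃! B₀ : Finset M, B₀ ⊆ B ∧ GoodPair R B₀ (C \ B)) ∧
    (∀ B₀ : Finset M, B₀ ⊆ B → GoodPair R B₀ (C \ B) →
      B₀ = B.filter fun b => ∃ ℓ ∈ linesOf R C, b ∈ ℓ ∧ (ℓ ∩ (C \ B)).Nonempty) ∧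
    (∀ ℓ ∈ linesOf R C, (ℓ ∩ B).Nonempty → (ℓ ∩ (C \ B)).Nonempty →
      2 ≤ (ℓ ∩ (C \ B)).card) := by
  have hC : B ∪ C \ B = C := Finset.union_sdiff_of_subset hBC.1
  have hz : ZeroPrimOver R B (C \ B) :=
    ⟨Finset.disjoint_sdiff, Finset.sdiff_nonempty.2 hBC.2, by rwa [hC], by rwa [hC]⟩
  have hgood : ∀ B₀ ⊆ B, (GoodPair R B₀ (C \ B) ↔ B₀ = lineBase R B C) :=
    fun B₀ hB₀ => hz.goodPair_iff hLS hBC.1 hcard hB₀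
  have hbase : lineBase R B C ⊆ B := Finset.filter_subset _ _
  refine ⟨⟨lineBase R B C, ⟨hbase, (hgood _ hbase).2 rfl⟩, fun B₀ h => (hgood B₀ h.1).1 h.2⟩,
    fun B₀ hB₀ h => (hgood B₀ hB₀).1 h, fun ℓ hℓ _ hA => ?_⟩
  exact hz.two_le_card_inter hLS hcard (hC.symm ▸ hℓ) hA
end

section
/- For each k ≥ 1 let D_k be the finite linear space with point set {a, b, c₁, …, c_{4k}} (all distinct) whose nontrivial lines are exactly the 4k three-element sets {a, c_{2i−1}, c_{2i}} for 1 ≤ i ≤ 2k, {b, c_{2i}, c_{2i+1}} for 1 ≤ i ≤ 2k − 1, and {b, c_{4k}, c₁} (an (a,b)-cycle of length 4k). Then D_k ∈ K₀, δ(D_k) = 2 = δ({a,b}), the set {c₁,…,c_{4k}} is 0-primitive over {a,b}, and ({a,b}, {c₁,…,c_{4k}}) is a good pair. Moreover, for k ≠ k' the good pairs ({a,b}, C_k) and ({a,b}, C_{k'}) are non-isomorphic; hence there are infinitely many pairwise non-isomorphic good pairs in K₀ over a two-element base. -/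
open scoped Classical

/-- The `4k` three-element lines of the `(a,b)`-cycle of length `4k` (points
`c 0, …, c (4k-1)` standing for `c₁, …, c_{4k}`). -/
def IsCycleLine {M : Type*} (a b : M) (c : ℕ → M) (k : ℕ) (ℓ : Finset M) : Prop :=
  (∃ j < 2 * k, ℓ = ({a, c (2 * j), c (2 * j + 1)} : Finset M)) ∨
  (∃ j < 2 * k - 1, ℓ = ({b, c (2 * j + 1), c (2 * j + 2)} : Finset M)) ∨
  ℓ = ({b, c (4 * k - 1), c 0} : Finset M)

/-- The finite linear space `D_k`: points `a, b, c₁, …, c_{4k}` (all distinct), whose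
nontrivial lines are exactly the `4k` cycle lines. -/
structure CycleConfig {M : Type*} (R : M → M → M → Prop) (k : ℕ) (a b : M)
    (c : ℕ → M) : Prop where
  hk : 1 ≤ k
  hab : a ≠ b
  hinj : Set.InjOn c (Set.Iio (4 * k))
  hca : ∀ i < 4 * k, c i ≠ a
  hcb : ∀ i < 4 * k, c i ≠ b
  hR : ∀ x y z : M,
    x ∈ insert a (insert b ((Finset.range (4 * k)).image c)) →
    y ∈ insert a (insert b ((Finset.range (4 * k)).image c)) →
    z ∈ insert a (insert b ((Finset.range (4 * k)).image c)) →
    (R x y z ↔ x ≠ y ∧ y ≠ z ∧ x ≠ z ∧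
      ∃ ℓ : Finset M, IsCycleLine a b c k ℓ ∧ x ∈ ℓ ∧ y ∈ ℓ ∧ z ∈ ℓ)

/-- An isomorphism of good pairs `(B, A)` and `(B', A')`: an isomorphism of the induced
linear spaces from `B ∪ A` onto `B' ∪ A'` carrying `B` onto `B'`. -/
def GoodPairIso {M N : Type*} (R : M → M → M → Prop) (S : N → N → N → Prop)
    (B A : Finset M) (B' A' : Finset N) : Prop :=
  ∃ f : M → N, Set.InjOn f ↑(B ∪ A) ∧ (B ∪ A).image f = B' ∪ A' ∧ B.image f = B' ∧
    ∀ x ∈ B ∪ A, ∀ y ∈ B ∪ A, ∀ z ∈ B ∪ A, (R x y z ↔ S (f x) (f y) (f z))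

/-- The cyclic successor on `{0, …, n - 1}`. -/
def cycSucc (n i : ℕ) : ℕ := if i + 1 = n then 0 else i + 1

/-- The `i`-th line of an `(a,b)`-cycle of length `n`. -/
noncomputable def cycLine {M : Type*} (a b : M) (c : ℕ → M) (n i : ℕ) : Finset M :=
  {if i % 2 = 0 then a else b, c i, c (cycSucc n i)}

/-- The point set of an `(a,b)`-cycle of length `n`. -/
noncomputable def cycPoints {M : Type*} (a b : M) (c : ℕ → M) (n : ℕ) : Finset M :=
  insert a (insert b ((Finset.range n).image c))

theorem cycSucc_lt {n i : ℕ} (hi : i < n) : cycSucc n i < n := by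
  unfold cycSucc; split_ifs <;> omega

theorem cycSucc_ne {n i : ℕ} (hn : 1 < n) : i ≠ cycSucc n i := by
  unfold cycSucc; split_ifs <;> omega

theorem eq_of_cycSucc {n i j : ℕ} (hn : 2 < n) (h1 : i = j ∨ i = cycSucc n j)
    (h2 : cycSucc n i = j ∨ cycSucc n i = cycSucc n j) : i = j := by
  grind [cycSucc]

theorem isCycleLine_iff {M : Type*} {a b : M} {c : ℕ → M} {k : ℕ} (hk : 1 ≤ k) (ℓ : Finset M) :
    IsCycleLine a b c k ℓ ↔ ∃ i < 4 * k, ℓ = cycLine a b c (4 * k) i := by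
  constructor
  · rintro (⟨j, hj, rfl⟩ | ⟨j, hj, rfl⟩ | rfl)
    · refine ⟨2 * j, by omega, ?_⟩
      rw [cycLine, cycSucc, if_pos (by omega), if_neg (by omega)]
    · refine ⟨2 * j + 1, by omega, ?_⟩
      rw [cycLine, cycSucc, if_neg (by omega), if_neg (by omega)]
    · refine ⟨4 * k - 1, by omega, ?_⟩
      rw [cycLine, cycSucc, if_neg (by omega), if_pos (by omega)]
  · rintro ⟨i, hi, rfl⟩
    rcases Nat.even_or_odd' i with ⟨j, rfl | rfl⟩
    · refine Or.inl ⟨j, by omega, ?_⟩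
      rw [cycLine, cycSucc, if_pos (by omega), if_neg (by omega)]
    · by_cases h : 2 * j + 1 + 1 = 4 * k
      · refine Or.inr (Or.inr ?_)
        rw [cycLine, cycSucc, if_neg (by omega), if_pos h, ← h, Nat.add_sub_cancel]
      · refine Or.inr (Or.inl ⟨j, by omega, ?_⟩)
        rw [cycLine, cycSucc, if_neg (by omega), if_neg h]

namespace CycleConfig

variable {M : Type*} {R : M → M → M → Prop} {k : ℕ} {a b : M} {c : ℕ → M}

theorem c_inj (h : CycleConfig R k a b c) {i j : ℕ} (hi : i < 4 * k) (hj : j < 4 * k)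
    (hij : c i = c j) : i = j :=
  h.hinj hi hj hij

theorem c_ne_c_succ (h : CycleConfig R k a b c) {i : ℕ} (hi : i < 4 * k) :
    c i ≠ c (cycSucc (4 * k) i) := fun e =>
  cycSucc_ne (by have := h.hk; omega) (h.c_inj hi (cycSucc_lt hi) e)

theorem rel_iff (h : CycleConfig R k a b c) {x y z : M} (hx : x ∈ cycPoints a b c (4 * k))
    (hy : y ∈ cycPoints a b c (4 * k)) (hz : z ∈ cycPoints a b c (4 * k)) :
    R x y z ↔ x ≠ y ∧ y ≠ z ∧ x ≠ z ∧ ∃ i < 4 * k, x ∈ cycLine a b c (4 * k) i ∧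
      y ∈ cycLine a b c (4 * k) i ∧ z ∈ cycLine a b c (4 * k) i := by
  rw [h.hR x y z hx hy hz]
  simp only [isCycleLine_iff h.hk]
  constructor
  · rintro ⟨h1, h2, h3, _, ⟨i, hi, rfl⟩, h4⟩
    exact ⟨h1, h2, h3, i, hi, h4⟩
  · rintro ⟨h1, h2, h3, i, hi, h4⟩
    exact ⟨h1, h2, h3, _, ⟨i, hi, rfl⟩, h4⟩

theorem card_cycLine (h : CycleConfig R k a b c) {i : ℕ} (hi : i < 4 * k) :
    (cycLine a b c (4 * k) i).card = 3 := by
  have hs := cycSucc_lt hi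
  have hne := h.c_ne_c_succ hi
  have h1 := h.hca i hi
  have h2 := h.hcb i hi
  have h3 := h.hca _ hs
  have h4 := h.hcb _ hs
  rw [cycLine, Finset.card_eq_three]
  refine ⟨_, _, _, ?_, ?_, hne, rfl⟩ <;> split_ifs <;> exact Ne.symm (by assumption)

theorem c_mem_cycLine (h : CycleConfig R k a b c) {i j : ℕ} (hi : i < 4 * k) (hj : j < 4 * k)
    (hm : c j ∈ cycLine a b c (4 * k) i) : j = i ∨ j = cycSucc (4 * k) i := by
  simp only [cycLine, Finset.mem_insert, Finset.mem_singleton] at hm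
  rcases hm with hm | hm | hm
  · split_ifs at hm
    · exact absurd hm (h.hca j hj)
    · exact absurd hm (h.hcb j hj)
  · exact Or.inl (h.c_inj hj hi hm)
  · exact Or.inr (h.c_inj hj (cycSucc_lt hi) hm)

theorem eq_of_c_mem (h : CycleConfig R k a b c) {i j : ℕ} (hi : i < 4 * k) (hj : j < 4 * k)
    (h1 : c i ∈ cycLine a b c (4 * k) j) (h2 : c (cycSucc (4 * k) i) ∈ cycLine a b c (4 * k) j) :
    i = j := by
  have := h.hk
  exact eq_of_cycSucc (by omega) (h.c_mem_cycLine hj hi h1) (h.c_mem_cycLine hj (cycSucc_lt hi) h2)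

theorem c_mem (i : ℕ) : c i ∈ cycLine a b c (4 * k) i := by simp [cycLine]

theorem c_succ_mem (i : ℕ) : c (cycSucc (4 * k) i) ∈ cycLine a b c (4 * k) i := by simp [cycLine]

theorem cycLine_injOn (h : CycleConfig R k a b c) :
    Set.InjOn (cycLine a b c (4 * k)) (Set.Iio (4 * k)) := fun i hi _ hj e =>
  h.eq_of_c_mem hi hj (e ▸ c_mem i) (e ▸ c_succ_mem i)

theorem cycLine_subset {i : ℕ} (hi : i < 4 * k) :
    cycLine a b c (4 * k) i ⊆ cycPoints a b c (4 * k) := by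
  have hs := cycSucc_lt hi
  intro x hx
  simp only [cycLine, cycPoints, Finset.mem_insert, Finset.mem_singleton, Finset.mem_image,
    Finset.mem_range] at hx ⊢
  rcases hx with hx | hx | hx
  · split_ifs at hx <;> tauto
  · exact Or.inr (Or.inr ⟨i, hi, hx.symm⟩)
  · exact Or.inr (Or.inr ⟨_, hs, hx.symm⟩)

theorem eq_of_cycLine_subset_clique (h : CycleConfig R k a b c) {i : ℕ} (hi : i < 4 * k)
    {ℓ : Finset M} (hℓ : ℓ ⊆ cycPoints a b c (4 * k)) (hc : FinClique R ℓ)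
    (hs : cycLine a b c (4 * k) i ⊆ ℓ) : ℓ = cycLine a b c (4 * k) i := by
  refine Finset.Subset.antisymm (fun w hw => ?_) hs
  by_contra hn
  have h1 := hs (c_mem (k := k) i)
  have h2 := hs (c_succ_mem (k := k) i)
  have hr := hc _ h1 _ h2 _ hw (h.c_ne_c_succ hi) (fun e => hn (e ▸ c_succ_mem i)) (fun e => hn (e ▸ c_mem i))
  obtain ⟨-, -, -, j, hj, m1, m2, m3⟩ := (h.rel_iff (hℓ h1) (hℓ h2) (hℓ hw)).1 hr
  obtain rfl := h.eq_of_c_mem hi hj m1 m2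
  exact hn m3

theorem isLineOf_iff (h : CycleConfig R k a b c) {X : Finset M}
    (hX : X ⊆ cycPoints a b c (4 * k)) (ℓ : Finset M) :
    IsLineOf R X ℓ ↔ ∃ i < 4 * k, cycLine a b c (4 * k) i ⊆ X ∧ cycLine a b c (4 * k) i = ℓ := by
  constructor
  · rintro ⟨hs, h3, hc, -⟩
    obtain ⟨x, y, z, hx, hy, hz, hxy, hxz, hyz⟩ := Finset.two_lt_card_iff.1 h3
    obtain ⟨-, -, -, i, hi, m1, m2, m3⟩ :=
      (h.rel_iff (hX (hs hx)) (hX (hs hy)) (hX (hs hz))).1 (hc x hx y hy z hz hxy hyz hxz)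
    have hxyz : ({x, y, z} : Finset M) = cycLine a b c (4 * k) i := by
      refine Finset.eq_of_subset_of_card_le ?_ ?_
      · simp [Finset.insert_subset_iff, m1, m2, m3]
      · rw [h.card_cycLine hi, Finset.card_eq_three.2 ⟨x, y, z, hxy, hxz, hyz, rfl⟩]
    have hsub : cycLine a b c (4 * k) i ⊆ ℓ := by
      rw [← hxyz]
      simp [Finset.insert_subset_iff, hx, hy, hz]
    exact ⟨i, hi, hsub.trans hs, (h.eq_of_cycLine_subset_clique hi (hs.trans hX) hc hsub).symm⟩
  · rintro ⟨i, hi, hs, rfl⟩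
    refine ⟨hs, (h.card_cycLine hi).ge, ?_, fun ℓ' h1 h2 h3 =>
      h.eq_of_cycLine_subset_clique hi (h1.trans hX) h2 h3⟩
    intro x hx y hy z hz hxy hyz hxz
    exact (h.rel_iff (hX (hs hx)) (hX (hs hy)) (hX (hs hz))).2 ⟨hxy, hyz, hxz, i, hi, hx, hy, hz⟩

theorem delta_eq (h : CycleConfig R k a b c) {X : Finset M} (hX : X ⊆ cycPoints a b c (4 * k)) :
    delta R X = X.card -
      ((Finset.range (4 * k)).filter fun i => cycLine a b c (4 * k) i ⊆ X).card := by
  have hl : linesOf R X = ((Finset.range (4 * k)).filter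
      fun i => cycLine a b c (4 * k) i ⊆ X).image (cycLine a b c (4 * k)) := by
    ext ℓ
    simp only [linesOf, Finset.mem_filter, Finset.mem_powerset, h.isLineOf_iff hX,
      Finset.mem_image, Finset.mem_range]
    constructor
    · rintro ⟨-, i, hi, hs, rfl⟩
      exact ⟨i, ⟨hi, hs⟩, rfl⟩
    · rintro ⟨i, ⟨hi, hs⟩, rfl⟩
      exact ⟨hs, i, hi, hs, rfl⟩
  have hinj : Set.InjOn (cycLine a b c (4 * k)) ((Finset.range (4 * k)).filter
      fun i => cycLine a b c (4 * k) i ⊆ X : Finset ℕ) := fun i hi j hj e => by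
    simp only [Finset.coe_filter, Finset.mem_range, Set.mem_ofPred_eq] at hi hj
    exact h.cycLine_injOn hi.1 hj.1 e
  rw [delta, hl, Finset.sum_image hinj, Finset.sum_congr rfl (g := fun _ => (1 : ℤ))]
  · simp
  · intro i hi
    rw [h.card_cycLine (Finset.mem_range.1 (Finset.mem_filter.1 hi).1)]
    norm_num

theorem card_image (h : CycleConfig R k a b c) {s : Finset ℕ} (hs : s ⊆ Finset.range (4 * k)) :
    (s.image c).card = s.card :=
  Finset.card_image_of_injOn fun _ hi _ hj e =>
    h.c_inj (Finset.mem_range.1 (hs hi)) (Finset.mem_range.1 (hs hj)) e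

theorem card_image_range (h : CycleConfig R k a b c) :
    ((Finset.range (4 * k)).image c).card = 4 * k := by
  rw [h.card_image subset_rfl, Finset.card_range]

theorem filter_cycLine_subset (X : Finset M) :
    ((Finset.range (4 * k)).filter fun i => cycLine a b c (4 * k) i ⊆ X) ⊆
      (Finset.range (4 * k)).filter fun i => c i ∈ X :=
  Finset.monotone_filter_right _ fun i _ hi => hi (c_mem i)

theorem inK0 (h : CycleConfig R k a b c) : InK0 R (cycPoints a b c (4 * k)) := by
  intro X hX
  rw [h.delta_eq hX]
  have h1 := Finset.card_le_card (filter_cycLine_subset (k := k) (a := a) (b := b) (c := c) X)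
  have h2 : (((Finset.range (4 * k)).filter fun i => c i ∈ X).image c).card ≤ X.card :=
    Finset.card_le_card fun x hx => by
      simp only [Finset.mem_image, Finset.mem_filter] at hx
      obtain ⟨i, hi, rfl⟩ := hx
      exact hi.2
  rw [h.card_image (Finset.filter_subset _ _)] at h2
  omega

theorem disjoint_points (h : CycleConfig R k a b c) :
    Disjoint ({a, b} : Finset M) ((Finset.range (4 * k)).image c) := by
  rw [Finset.disjoint_left]
  intro x hx hm
  simp only [Finset.mem_image, Finset.mem_range] at hm
  obtain ⟨i, hi, rfl⟩ := hm
  simp [h.hca i hi, h.hcb i hi] at hx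

theorem union_eq : ({a, b} : Finset M) ∪ (Finset.range (4 * k)).image c =
    cycPoints a b c (4 * k) := by
  simp [cycPoints, Finset.insert_union]

theorem card_points (h : CycleConfig R k a b c) : (cycPoints a b c (4 * k)).card = 4 * k + 2 := by
  rw [← union_eq, Finset.card_union_of_disjoint h.disjoint_points, h.card_image_range,
    Finset.card_pair h.hab, add_comm]

theorem delta_points (h : CycleConfig R k a b c) : delta R (cycPoints a b c (4 * k)) = 2 := by
  rw [h.delta_eq subset_rfl, h.card_points, Finset.filter_true_of_mem fun i hi =>
    cycLine_subset (Finset.mem_range.1 hi)]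
  simp

theorem delta_of_subset_base (h : CycleConfig R k a b c) {X : Finset M} (hX : X ⊆ {a, b}) :
    delta R X = X.card := by
  rw [h.delta_eq (hX.trans (union_eq (k := k) (c := c) ▸ Finset.subset_union_left)),
    Finset.filter_false_of_mem]
  · simp
  · intro i hi hs
    have hi := Finset.mem_range.1 hi
    have := hX (hs (c_mem (k := k) i))
    simp [h.hca i hi, h.hcb i hi] at this

theorem delta_base (h : CycleConfig R k a b c) : delta R ({a, b} : Finset M) = 2 := by
  rw [h.delta_of_subset_base subset_rfl, Finset.card_pair h.hab]
  rfl

theorem eq_base_union {X : Finset M} (hB : {a, b} ⊆ X)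
    (hX : X ⊆ cycPoints a b c (4 * k)) :
    X = {a, b} ∪ ((Finset.range (4 * k)).filter fun i => c i ∈ X).image c := by
  ext x
  constructor
  · intro hx
    have := hX hx
    simp only [cycPoints, Finset.mem_insert, Finset.mem_image, Finset.mem_range] at this
    rcases this with rfl | rfl | ⟨i, hi, rfl⟩
    · simp
    · simp
    · exact Finset.mem_union_right _ (Finset.mem_image_of_mem _ (by simp [hi, hx]))
  · intro hx
    rcases Finset.mem_union.1 hx with hx | hx
    · exact hB hx
    · obtain ⟨i, hi, rfl⟩ := Finset.mem_image.1 hx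
      exact (Finset.mem_filter.1 hi).2

theorem card_of_base_subset (h : CycleConfig R k a b c) {X : Finset M} (hB : {a, b} ⊆ X)
    (hX : X ⊆ cycPoints a b c (4 * k)) :
    X.card = ((Finset.range (4 * k)).filter fun i => c i ∈ X).card + 2 := by
  conv_lhs => rw [eq_base_union hB hX]
  rw [Finset.card_union_of_disjoint, Finset.card_pair h.hab, h.card_image (Finset.filter_subset _ _), add_comm]
  exact h.disjoint_points.mono_right (Finset.image_subset_image (Finset.filter_subset _ _))

theorem two_le_delta (h : CycleConfig R k a b c) {X : Finset M} (hB : {a, b} ⊆ X)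
    (hX : X ⊆ cycPoints a b c (4 * k)) : 2 ≤ delta R X := by
  rw [h.delta_eq hX, h.card_of_base_subset hB hX]
  have := Finset.card_le_card (filter_cycLine_subset (k := k) (a := a) (b := b) (c := c) X)
  push_cast
  omega

theorem two_lt_delta (h : CycleConfig R k a b c) {X : Finset M} (hB : {a, b} ⊂ X)
    (hX : X ⊂ cycPoints a b c (4 * k)) : 2 < delta R X := by
  rw [h.delta_eq hX.subset, h.card_of_base_subset hB.subset hX.subset]
  suffices ((Finset.range (4 * k)).filter fun i => cycLine a b c (4 * k) i ⊆ X).card <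
      ((Finset.range (4 * k)).filter fun i => c i ∈ X).card by
    push_cast
    omega
  refine Finset.card_lt_card ((filter_cycLine_subset X).ssubset_of_ne fun e => ?_)
  have step : ∀ i < 4 * k, c i ∈ X → c (cycSucc (4 * k) i) ∈ X := fun i hi hm => by
    have : i ∈ (Finset.range (4 * k)).filter fun i => cycLine a b c (4 * k) i ⊆ X := by
      rw [e]
      simp [hi, hm]
    exact (Finset.mem_filter.1 this).2 (c_succ_mem i)
  have up : ∀ i, c i ∈ X → ∀ d, i + d < 4 * k → c (i + d) ∈ X := fun i hm d => by
    induction d with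
    | zero => exact fun _ => hm
    | succ d ih =>
      intro hd
      have := step (i + d) (by omega) (ih (by omega))
      rwa [cycSucc, if_neg (by omega)] at this
  have hex : ∃ i < 4 * k, c i ∈ X := by
    by_contra! hn
    refine hB.ne ?_
    rw [eq_base_union hB.subset hX.subset, Finset.filter_false_of_mem fun i hi =>
      hn i (Finset.mem_range.1 hi)]
    simp
  obtain ⟨i, hi, hm⟩ := hex
  have hlast := up i hm (4 * k - 1 - i) (by omega)
  have hzero := step _ (by omega) hlast
  rw [cycSucc, if_pos (by omega)] at hzero
  refine hX.ne ?_
  rw [eq_base_union hB.subset hX.subset, Finset.filter_true_of_mem, union_eq]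
  intro j hj
  simpa using up 0 hzero j (by simpa using hj)

theorem zeroPrimOver (h : CycleConfig R k a b c) :
    ZeroPrimOver R ({a, b} : Finset M) ((Finset.range (4 * k)).image c) := by
  have hk := h.hk
  refine ⟨h.disjoint_points, ⟨c 0, Finset.mem_image_of_mem _ (by simp; omega)⟩, ?_, ?_⟩
  · rw [union_eq]
    refine ⟨⟨union_eq (k := k) (c := c) ▸ Finset.subset_union_left, fun X h1 h2 => ?_⟩, ?_⟩
    · rw [h.delta_base]
      exact h.two_le_delta h1 h2
    · rintro ⟨X, h1, h2, -, h3⟩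
      have h4 := h3.2 _ h2.subset subset_rfl
      rw [h.delta_points] at h4
      exact absurd (h.two_lt_delta h1 h2) (not_lt.2 h4)
  · rw [union_eq, h.delta_points, h.delta_base]

theorem not_zeroPrimOver (h : CycleConfig R k a b c) {B : Finset M} (hB : B ⊂ {a, b}) :
    ¬ ZeroPrimOver R B ((Finset.range (4 * k)).image c) := by
  rintro ⟨hd, -, -, he⟩
  have hk := h.hk
  have hsub : B ∪ (Finset.range (4 * k)).image c ⊆ cycPoints a b c (4 * k) :=
    union_eq (k := k) (c := c) ▸ Finset.union_subset_union_left hB.subset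
  rw [h.delta_of_subset_base hB.subset, h.delta_eq hsub, Finset.card_union_of_disjoint hd,
    h.card_image_range] at he
  have hlt : ((Finset.range (4 * k)).filter fun i => cycLine a b c (4 * k) i ⊆
      B ∪ (Finset.range (4 * k)).image c).card < (Finset.range (4 * k)).card := by
    refine Finset.card_lt_card (Finset.filter_ssubset.2 ?_)
    by_contra! hall
    refine hB.2 ?_
    have hc : ∀ x ∈ ({a, b} : Finset M), x ∈ B ∪ (Finset.range (4 * k)).image c → x ∈ B :=
      fun x hx hm => (Finset.mem_union.1 hm).resolve_right
        (Finset.disjoint_left.1 h.disjoint_points hx)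
    intro x hx
    refine hc x hx ?_
    rcases Finset.mem_insert.1 hx with rfl | hx
    · exact hall 0 (by simp; omega) (by simp [cycLine])
    · rw [Finset.mem_singleton.1 hx]
      exact hall 1 (by simp; omega) (by simp [cycLine])
  rw [Finset.card_range] at hlt
  push_cast at he
  omega

theorem goodPair (h : CycleConfig R k a b c) :
    GoodPair R ({a, b} : Finset M) ((Finset.range (4 * k)).image c) :=
  ⟨h.zeroPrimOver, fun _ => h.not_zeroPrimOver⟩

theorem eq_of_goodPairIso (h : CycleConfig R k a b c) {N : Type*} {S : N → N → N → Prop}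
    {k' : ℕ} {a' b' : N} {c' : ℕ → N} (h' : CycleConfig S k' a' b' c')
    (hiso : GoodPairIso R S ({a, b} : Finset M) ((Finset.range (4 * k)).image c)
      ({a', b'} : Finset N) ((Finset.range (4 * k')).image c')) : k = k' := by
  obtain ⟨f, hinj, him, -⟩ := hiso
  have hcard := Finset.card_image_of_injOn hinj
  rw [him, union_eq, union_eq, h.card_points, h'.card_points] at hcard
  omega

end CycleConfig

/-- For every `k ≥ 1`, the `(a,b)`-cycle `D_k` of length `4k` is in `K₀`,
`δ(D_k) = 2 = δ({a,b})`, `C_k = {c₁,…,c_{4k}}` is `0`-primitive over `{a,b}`, and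
`({a,b}, C_k)` is a good pair; moreover for `k ≠ k'` the good pairs `({a,b}, C_k)` and
`({a',b'}, C_{k'})` are non-isomorphic (hence there are infinitely many pairwise
non-isomorphic good pairs in `K₀` over a two-element base). -/
theorem cycle_good_pairs {M N : Type*} (R : M → M → M → Prop) (S : N → N → N → Prop)
    (hLSR : IsLinearSpace R) (hLSS : IsLinearSpace S)
    (k k' : ℕ) (a b : M) (c : ℕ → M) (a' b' : N) (c' : ℕ → N)
    (hcfg : CycleConfig R k a b c) (hcfg' : CycleConfig S k' a' b' c') :
    InK0 R (insert a (insert b ((Finset.range (4 * k)).image c))) ∧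
    delta R (insert a (insert b ((Finset.range (4 * k)).image c))) = 2 ∧
    delta R ({a, b} : Finset M) = 2 ∧
    ZeroPrimOver R ({a, b} : Finset M) ((Finset.range (4 * k)).image c) ∧
    GoodPair R ({a, b} : Finset M) ((Finset.range (4 * k)).image c) ∧
    (k ≠ k' → ¬ GoodPairIso R S ({a, b} : Finset M) ((Finset.range (4 * k)).image c)
      ({a', b'} : Finset N) ((Finset.range (4 * k')).image c')) := by
  exact ⟨hcfg.inK0, hcfg.delta_points, hcfg.delta_base, hcfg.zeroPrimOver, hcfg.goodPair,
    fun hne hiso => hne (hcfg.eq_of_goodPairIso hcfg' hiso)⟩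
end
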